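/- Let f be an integral binary quartic form with Disc(f) ≠ 0. Then the number of pairs (x,y) ∈ ℤ² with |f(x,y)| = 1, counted up to the identification (x,y) ∼ (−x,−y), is at most 276. -/

import Mathlib

/-- Evaluation of the binary quartic form with coefficients `a, b, c, d, e` at `(x, y)`. -/
def quarticEval (a b c d e x y : ℤ) : ℤ :=
  a * x ^ 4 + b * x ^ 3 * y + c * x ^ 2 * y ^ 2 + d * x * y ^ 3 + e * y ^ 4

/-- The discriminant of the integral binary quartic form `ax⁴ + bx³y + cx²y² + dxy³ + ey⁴`. -/
def quarticDisc (a b c d e : ℤ) : ℤ :=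
  256 * a ^ 3 * e ^ 3 - 192 * a ^ 2 * b * d * e ^ 2 - 128 * a ^ 2 * c ^ 2 * e ^ 2
    + 144 * a ^ 2 * c * d ^ 2 * e - 27 * a ^ 2 * d ^ 4 + 144 * a * b ^ 2 * c * e ^ 2
    - 6 * a * b ^ 2 * d ^ 2 * e - 80 * a * b * c ^ 2 * d * e + 18 * a * b * c * d ^ 3
    + 16 * a * c ^ 4 * e - 4 * a * c ^ 3 * d ^ 2 - 27 * b ^ 4 * e ^ 2
    + 18 * b ^ 3 * c * d * e - 4 * b ^ 3 * d ^ 3 - 4 * b ^ 2 * c ^ 3 * e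
    + b ^ 2 * c ^ 2 * d ^ 2

open scoped ComplexOrder in
/-- A form of Hadamard's inequality: entries of norm at most one. -/
theorem norm_det_sq_le_of_entries_le_one {n : ℕ} (hn : n ≠ 0) (B : Matrix (Fin n) (Fin n) ℂ)
    (hB : ∀ i j, ‖B i j‖ ≤ 1) : ‖B.det‖ ^ 2 ≤ (n : ℝ) ^ n := by
  have hpsd : (B * B.conjTranspose).PosSemidef := Matrix.posSemidef_self_mul_conjTranspose B
  set lam := hpsd.isHermitian.eigenvalues with hlam
  have hnn : ∀ i, 0 ≤ lam i := hpsd.eigenvalues_nonneg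
  have hdet : ‖B.det‖ ^ 2 = ∏ i, lam i := by
    have h := hpsd.isHermitian.det_eq_prod_eigenvalues
    rw [Matrix.det_mul, Matrix.det_conjTranspose] at h
    have h2 := congrArg norm h
    rw [norm_mul, norm_star, norm_prod] at h2
    rw [sq, h2]
    refine Finset.prod_congr rfl fun i _ => ?_
    simpa [hlam] using hnn i
  have htr : ∑ i, lam i ≤ (n : ℝ) * n := by
    have h := hpsd.isHermitian.trace_eq_sum_eigenvalues
    have h1 : ((∑ i, lam i : ℝ) : ℂ) = ((∑ i, ∑ j, ‖B i j‖ ^ 2 : ℝ) : ℂ) := by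
      have : (B * B.conjTranspose).trace = ∑ i, ∑ j, ((‖B i j‖ ^ 2 : ℝ) : ℂ) := by
        simp only [Matrix.trace, Matrix.diag, Matrix.mul_apply, Matrix.conjTranspose_apply]
        refine Finset.sum_congr rfl fun i _ => Finset.sum_congr rfl fun j _ => ?_
        rw [RCLike.star_def, Complex.mul_conj, Complex.normSq_eq_norm_sq]
      rw [this] at h
      push_cast at h ⊢
      exact h.symm
    rw [Complex.ofReal_injective h1]
    calc ∑ i, ∑ j, ‖B i j‖ ^ 2 ≤ ∑ i : Fin n, ∑ j : Fin n, (1 : ℝ) := by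
          gcongr with i _ j _
          exact pow_le_one₀ (norm_nonneg _) (hB i j)
      _ = (n : ℝ) * n := by simp
  have hn0 : (0 : ℝ) < n := by positivity
  have ham := Real.geom_mean_le_arith_mean_weighted Finset.univ (fun _ : Fin n => (1 / n : ℝ)) lam
    (fun _ _ => by positivity) (by simp [hn]) (fun i _ => hnn i)
  rw [← Finset.mul_sum] at ham
  have hle : ∏ i, lam i ^ (1 / n : ℝ) ≤ n := by
    refine ham.trans ?_
    rw [one_div, inv_mul_le_iff₀ hn0]
    exact htr
  have hpow : (∏ i, lam i ^ (1 / n : ℝ)) ^ n = ∏ i, lam i := by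
    rw [← Finset.prod_pow]
    refine Finset.prod_congr rfl fun i _ => ?_
    rw [one_div, Real.rpow_inv_natCast_pow (hnn i) hn]
  rw [hdet, ← hpow]
  exact pow_le_pow_left₀ (Finset.prod_nonneg fun i _ => Real.rpow_nonneg (hnn i) _) hle n

theorem norm_det_vandermonde_sq_le {n : ℕ} (z : Fin (n + 1) → ℂ) :
    ‖(Matrix.vandermonde z).det‖ ^ 2 ≤
      ((n : ℝ) + 1) ^ (n + 1) * (∏ i, max 1 ‖z i‖) ^ (2 * n) := by
  have hpos : ∀ i, (0 : ℝ) < max 1 ‖z i‖ := fun i => lt_of_lt_of_le one_pos (le_max_left _ _)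
  set c : Fin (n + 1) → ℂ := fun i => ((((max 1 ‖z i‖) ^ n)⁻¹ : ℝ) : ℂ) with hc
  have h := norm_det_sq_le_of_entries_le_one (Nat.succ_ne_zero n)
    (Matrix.of fun i j => c i * Matrix.vandermonde z i j) (fun i j => by
      simp only [Matrix.of_apply, Matrix.vandermonde_apply, hc, norm_mul, norm_pow]
      rw [Complex.norm_real, Real.norm_of_nonneg (by have := hpos i; positivity),
        inv_mul_le_iff₀ (by have := hpos i; positivity), mul_one]
      calc ‖z i‖ ^ (j : ℕ) ≤ (max 1 ‖z i‖) ^ (j : ℕ) := by gcongr; exact le_max_right _ _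
        _ ≤ (max 1 ‖z i‖) ^ n := pow_le_pow_right₀ (le_max_left _ _) (by omega))
  rw [Matrix.det_mul_column, norm_mul, mul_pow] at h
  have h2 : ‖∏ i, c i‖ = ((∏ i, max 1 ‖z i‖) ^ n)⁻¹ := by
    rw [norm_prod, ← Finset.prod_pow, ← Finset.prod_inv_distrib]
    refine Finset.prod_congr rfl fun i _ => ?_
    rw [hc, Complex.norm_real, Real.norm_of_nonneg (by have := hpos i; positivity)]
  have hP : 0 < ∏ i, max 1 ‖z i‖ := Finset.prod_pos fun i _ => hpos i
  rw [h2, inv_pow, inv_mul_le_iff₀ (by positivity), ← pow_mul, mul_comm n 2] at h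
  push_cast at h
  rw [mul_comm]; exact h

/-- The invariant of degree two of a binary quartic form. -/
def quarticI (a b c d e : ℤ) : ℤ := 12 * a * e - 3 * b * d + c ^ 2

/-- The invariant of degree three of a binary quartic form. -/
def quarticJ (a b c d e : ℤ) : ℤ :=
  72 * a * c * e + 9 * b * c * d - 27 * a * d ^ 2 - 27 * e * b ^ 2 - 2 * c ^ 3

theorem twentyseven_mul_quarticDisc (a b c d e : ℤ) :
    27 * quarticDisc a b c d e = 4 * quarticI a b c d e ^ 3 - quarticJ a b c d e ^ 2 := by
  simp only [quarticDisc, quarticI, quarticJ]; ring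

/-- A linear substitution `(X, Y) ↦ (xX + uY, yX + vY)` turns an integral quartic form into an
integral quartic form, and multiplies the discriminant by the twelfth power of the determinant. -/
theorem exists_quartic_subst (a b c d e x u y v : ℤ) :
    ∃ b' c' d' e' : ℤ,
      (∀ (R : Type) [CommRing R] (X Y : R),
        a * (x * X + u * Y) ^ 4 + b * (x * X + u * Y) ^ 3 * (y * X + v * Y)
          + c * (x * X + u * Y) ^ 2 * (y * X + v * Y) ^ 2
          + d * (x * X + u * Y) * (y * X + v * Y) ^ 3 + e * (y * X + v * Y) ^ 4
        = (quarticEval a b c d e x y : ℤ) * X ^ 4 + b' * X ^ 3 * Y + c' * X ^ 2 * Y ^ 2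
          + d' * X * Y ^ 3 + e' * Y ^ 4) ∧
      quarticDisc (quarticEval a b c d e x y) b' c' d' e'
        = quarticDisc a b c d e * (x * v - u * y) ^ 12 := by
  refine ⟨4*a*x^3*u + b*(x^3*v+3*x^2*y*u) + c*(2*x^2*y*v+2*x*y^2*u) + d*(y^3*u+3*x*y^2*v)
      + 4*e*y^3*v,
    6*a*x^2*u^2 + b*(3*x^2*u*v+3*x*y*u^2) + c*(x^2*v^2+4*x*y*u*v+y^2*u^2)
      + d*(3*y^2*u*v+3*x*y*v^2) + 6*e*y^2*v^2,
    4*a*x*u^3 + b*(y*u^3+3*x*u^2*v) + c*(2*x*u*v^2+2*u^2*y*v) + d*(x*v^3+3*y*u*v^2) + 4*e*y*v^3,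
    quarticEval a b c d e u v, ?_, ?_⟩
  · intro R _ X Y
    simp only [quarticEval]
    push_cast
    ring
  · have hI := twentyseven_mul_quarticDisc a b c d e
    apply mul_left_cancel₀ (show (27 : ℤ) ≠ 0 by norm_num)
    rw [twentyseven_mul_quarticDisc, ← mul_assoc, hI]
    have h1 : ∀ p q r s t : ℤ, p = q * s ^ 4 → r = t * s ^ 6 →
        4 * p ^ 3 - r ^ 2 = (4 * q ^ 3 - t ^ 2) * s ^ 12 := by
      rintro p q r s t rfl rfl; ring
    apply h1
    · simp only [quarticI, quarticEval]; ring
    · simp only [quarticJ, quarticEval]; ring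

theorem det_vandermonde_fin_four (α : Fin 4 → ℂ) :
    (Matrix.vandermonde α).det = (α 1 - α 0) * (α 2 - α 0) * (α 3 - α 0) * (α 2 - α 1)
      * (α 3 - α 1) * (α 3 - α 2) := by
  rw [Matrix.det_vandermonde]
  have h0 : Finset.Ioi (0 : Fin 4) = {1, 2, 3} := by decide
  have h1 : Finset.Ioi (1 : Fin 4) = {2, 3} := by decide
  have h2 : Finset.Ioi (2 : Fin 4) = {3} := by decide
  have h3 : Finset.Ioi (3 : Fin 4) = ∅ := by decide
  rw [Fin.prod_univ_four, h0, h1, h2, h3]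
  simp only [Finset.prod_insert, Finset.prod_singleton, Finset.prod_empty, Finset.mem_insert,
    Finset.mem_singleton, Fin.reduceEq, or_self, not_false_eq_true]
  ring

theorem det_vandermonde_fin_three (α : Fin 3 → ℂ) :
    (Matrix.vandermonde α).det = (α 1 - α 0) * (α 2 - α 0) * (α 2 - α 1) := by
  rw [Matrix.det_vandermonde]
  have h0 : Finset.Ioi (0 : Fin 3) = {1, 2} := by decide
  have h1 : Finset.Ioi (1 : Fin 3) = {2} := by decide
  have h2 : Finset.Ioi (2 : Fin 3) = ∅ := by decide
  simp [Fin.prod_univ_three, h0, h1, h2]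

/-- Vieta's formulas for a monic quartic. -/
theorem coeff_eq_of_prod_eq (α : Fin 4 → ℂ) (b c d e : ℤ)
    (h : ∀ X Y : ℂ, ∏ i, (X - α i * Y) =
      X ^ 4 + b * X ^ 3 * Y + c * X ^ 2 * Y ^ 2 + d * X * Y ^ 3 + e * Y ^ 4) :
    (b : ℂ) = -(α 0 + α 1 + α 2 + α 3) ∧
    (c : ℂ) = α 0 * α 1 + α 0 * α 2 + α 0 * α 3 + α 1 * α 2 + α 1 * α 3 + α 2 * α 3 ∧
    (d : ℂ) = -(α 0 * α 1 * α 2 + α 0 * α 1 * α 3 + α 0 * α 2 * α 3 + α 1 * α 2 * α 3) ∧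
    (e : ℂ) = α 0 * α 1 * α 2 * α 3 := by
  simp only [Fin.prod_univ_four] at h
  have h0 := h 0 1
  have h1 := h 1 1
  have h2 := h (-1) 1
  have h3 := h 2 1
  have he : (e : ℂ) = α 0 * α 1 * α 2 * α 3 := by linear_combination -h0
  have hc : (c : ℂ) = α 0 * α 1 + α 0 * α 2 + α 0 * α 3 + α 1 * α 2 + α 1 * α 3 + α 2 * α 3 := by
    linear_combination h0 - (h1 + h2) / 2
  have hb : (b : ℂ) = -(α 0 + α 1 + α 2 + α 3) := by
    linear_combination -(h3 - h1 + h2) / 6 - 2 / 3 * hc - he / 6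
  exact ⟨hb, hc, by linear_combination -h1 - hb - hc - he, he⟩

/-- The discriminant of a monic quartic in terms of its roots. -/
theorem quarticDisc_eq_det_vandermonde_sq (α : Fin 4 → ℂ) (b c d e : ℤ)
    (h : ∀ X Y : ℂ, ∏ i, (X - α i * Y) =
      X ^ 4 + b * X ^ 3 * Y + c * X ^ 2 * Y ^ 2 + d * X * Y ^ 3 + e * Y ^ 4) :
    ((quarticDisc 1 b c d e : ℤ) : ℂ) = (Matrix.vandermonde α).det ^ 2 := by
  obtain ⟨hb, hc, hd, he⟩ := coeff_eq_of_prod_eq α b c d e h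
  rw [det_vandermonde_fin_four]
  simp only [quarticDisc]
  push_cast
  rw [hb, hc, hd, he]
  ring

/-- A Mahler-type height of a quadruple of roots. -/
noncomputable def scaledHeight (α : Fin 4 → ℂ) : ℝ := ∏ i, max 1 (2 / 5 * ‖α i‖)

theorem one_le_scaledHeight (α : Fin 4 → ℂ) : 1 ≤ scaledHeight α :=
  Finset.one_le_prod fun _ _ => le_max_left _ _

theorem four_le_scaledHeight_pow {α : Fin 4 → ℂ} (h : 15625 ≤ ‖(Matrix.vandermonde α).det‖) :
    4 ≤ scaledHeight α ^ 3 := by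
  have h1 := norm_det_vandermonde_sq_le (fun i => (2 / 5 : ℂ) * α i)
  have h2 : (Matrix.vandermonde fun i => (2 / 5 : ℂ) * α i).det
      = (2 / 5) ^ 6 * (Matrix.vandermonde α).det := by
    simp only [det_vandermonde_fin_four]; ring
  have h3 : ∏ i, max 1 ‖(2 / 5 : ℂ) * α i‖ = scaledHeight α := by simp [scaledHeight]
  rw [h2, h3, norm_mul] at h1
  have h4 : ‖(2 / 5 : ℂ) ^ 6‖ = (2 / 5 : ℝ) ^ 6 := by simp
  rw [h4] at h1
  have h5 : (64 : ℝ) ≤ (2 / 5 : ℝ) ^ 6 * ‖(Matrix.vandermonde α).det‖ := by linarith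
  have h6 : (64 : ℝ) ^ 2 ≤ ((2 / 5 : ℝ) ^ 6 * ‖(Matrix.vandermonde α).det‖) ^ 2 := by gcongr
  have h7 := one_le_scaledHeight α
  have h8 : (4 : ℝ) ^ 2 ≤ (scaledHeight α ^ 3) ^ 2 := by
    norm_num at h1 h6 ⊢
    nlinarith
  exact le_of_sq_le_sq h8 (by positivity)

theorem norm_det_vandermonde_eq_succAbove (α : Fin 4 → ℂ) (i : Fin 4) :
    ‖(Matrix.vandermonde α).det‖ = (∏ j : Fin 3, ‖α (i.succAbove j) - α i‖)
      * ‖(Matrix.vandermonde fun j => α (i.succAbove j)).det‖ := by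
  rw [det_vandermonde_fin_four, det_vandermonde_fin_three, Fin.prod_univ_three]
  simp only [norm_mul]
  fin_cases i
  · change _ = ‖α 1 - α 0‖ * ‖α 2 - α 0‖ * ‖α 3 - α 0‖
      * (‖α 2 - α 1‖ * ‖α 3 - α 1‖ * ‖α 3 - α 2‖)
    ring
  · change _ = ‖α 0 - α 1‖ * ‖α 2 - α 1‖ * ‖α 3 - α 1‖
      * (‖α 2 - α 0‖ * ‖α 3 - α 0‖ * ‖α 3 - α 2‖)
    rw [norm_sub_rev (α 0)]
    ring
  · change _ = ‖α 0 - α 2‖ * ‖α 1 - α 2‖ * ‖α 3 - α 2‖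
      * (‖α 1 - α 0‖ * ‖α 3 - α 0‖ * ‖α 3 - α 1‖)
    rw [norm_sub_rev (α 0), norm_sub_rev (α 1) (α 2)]
    ring
  · change _ = ‖α 0 - α 3‖ * ‖α 1 - α 3‖ * ‖α 2 - α 3‖
      * (‖α 1 - α 0‖ * ‖α 2 - α 0‖ * ‖α 2 - α 1‖)
    rw [norm_sub_rev (α 0) (α 3), norm_sub_rev (α 1) (α 3), norm_sub_rev (α 2) (α 3)]
    ring

theorem le_scaledHeight_sq_mul_prod {α : Fin 4 → ℂ}
    (h : 15625 ≤ ‖(Matrix.vandermonde α).det‖) (i : Fin 4) :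
    192 ≤ scaledHeight α ^ 2 * ∏ j : Fin 3, ‖α (i.succAbove j) - α i‖ := by
  have h1 := norm_det_vandermonde_sq_le (fun j : Fin 3 => (2 / 5 : ℂ) * α (i.succAbove j))
  have h2 : (Matrix.vandermonde fun j : Fin 3 => (2 / 5 : ℂ) * α (i.succAbove j)).det
      = (2 / 5) ^ 3 * (Matrix.vandermonde fun j => α (i.succAbove j)).det := by
    simp only [det_vandermonde_fin_three]; ring
  have h3 : ∏ j : Fin 3, max 1 ‖(2 / 5 : ℂ) * α (i.succAbove j)‖ ≤ scaledHeight α := by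
    rw [scaledHeight, Fin.prod_univ_succAbove _ i]
    simp only [norm_mul, norm_div, Complex.norm_ofNat]
    exact le_mul_of_one_le_left (Finset.prod_nonneg fun j _ => by positivity) (le_max_left _ _)
  have h4 : ‖(2 / 5 : ℂ) ^ 3‖ = (2 / 5 : ℝ) ^ 3 := by simp
  rw [h2, norm_mul, h4] at h1
  rw [norm_det_vandermonde_eq_succAbove α i] at h
  set V := ‖(Matrix.vandermonde fun j => α (i.succAbove j)).det‖
  set P := ∏ j : Fin 3, ‖α (i.succAbove j) - α i‖
  set H := scaledHeight α
  have hH : 1 ≤ H := one_le_scaledHeight α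
  have hP : 0 ≤ P := Finset.prod_nonneg fun j _ => norm_nonneg _
  have hV : 0 ≤ V := norm_nonneg _
  have h5 : (∏ j : Fin 3, max 1 ‖(2 / 5 : ℂ) * α (i.succAbove j)‖) ^ (2 * 2) ≤ H ^ 4 :=
    pow_le_pow_left₀ (Finset.prod_nonneg fun j _ => by positivity) h3 4
  have h6 : V ^ 2 * 64 ≤ 27 * 15625 * H ^ 4 := by
    push_cast at h1
    norm_num at h1 h5
    linarith
  have h7 : (15625 : ℝ) ^ 2 ≤ (P * V) ^ 2 := by gcongr
  have h8 : (192 : ℝ) ^ 2 ≤ (H ^ 2 * P) ^ 2 := by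
    have : P ^ 2 * (V ^ 2 * 64) ≤ P ^ 2 * (27 * 15625 * H ^ 4) := by gcongr
    nlinarith
  exact le_of_sq_le_sq h8 (by positivity)

/-- The smallest linear factor at a solution of the quartic Thue equation is very small. -/
theorem norm_linear_factor_mul_le {α : Fin 4 → ℂ}
    (h : 15625 ≤ ‖(Matrix.vandermonde α).det‖) {x y : ℤ}
    (hxy : ‖∏ i, ((x : ℂ) - α i * y)‖ = 1) {i : Fin 4}
    (hi : ∀ j, ‖(x : ℂ) - α i * y‖ ≤ ‖(x : ℂ) - α j * y‖) :
    ‖(x : ℂ) - α i * y‖ * (|y| : ℝ) ^ 3 ≤ scaledHeight α ^ 2 / 24 := by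
  have h1 := le_scaledHeight_sq_mul_prod h i
  rw [Fin.prod_univ_succAbove _ i, norm_mul, norm_prod] at hxy
  set L := ‖(x : ℂ) - α i * y‖
  set P := ∏ j : Fin 3, ‖α (i.succAbove j) - α i‖
  have hL : 0 ≤ L := norm_nonneg _
  have h2 : P * (|y| : ℝ) ^ 3 ≤ 8 * ∏ j : Fin 3, ‖(x : ℂ) - α (i.succAbove j) * y‖ := by
    calc P * (|y| : ℝ) ^ 3 = ∏ j : Fin 3, ‖α (i.succAbove j) - α i‖ * (|y| : ℝ) := by
          rw [Finset.prod_mul_distrib]; simp [P]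
      _ ≤ ∏ j : Fin 3, 2 * ‖(x : ℂ) - α (i.succAbove j) * y‖ := by
          refine Finset.prod_le_prod (fun j _ => by positivity) fun j _ => ?_
          have e : (α (i.succAbove j) - α i) * y
              = ((x : ℂ) - α i * y) - (x - α (i.succAbove j) * y) := by ring
          have e2 := congrArg norm e
          rw [norm_mul, Complex.norm_intCast] at e2
          rw [e2]
          have := norm_sub_le ((x : ℂ) - α i * y) (x - α (i.succAbove j) * y)
          have := hi (i.succAbove j)
          linarith
      _ = _ := by rw [Finset.prod_mul_distrib]; simp; norm_num
  have h3 : L * (P * (|y| : ℝ) ^ 3) ≤ 8 := by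
    calc L * (P * (|y| : ℝ) ^ 3) ≤ L * (8 * _) := by gcongr
      _ = 8 * (L * ∏ j : Fin 3, ‖(x : ℂ) - α (i.succAbove j) * y‖) := by ring
      _ = 8 := by rw [hxy]; norm_num
  have h4 : 192 * (L * (|y| : ℝ) ^ 3) ≤ scaledHeight α ^ 2 * P * (L * (|y| : ℝ) ^ 3) := by gcongr
  have h5 : scaledHeight α ^ 2 * (L * (P * (|y| : ℝ) ^ 3)) ≤ scaledHeight α ^ 2 * 8 := by gcongr
  linarith

/-- `α` is the root vector of a monic integral binary quartic form of large discriminant that takes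
the values `±1` at no fewer than `N` pairwise non-parallel integral points. -/
def IsAdmissible (N : ℕ) (α : Fin 4 → ℂ) : Prop :=
  (∃ b c d e : ℤ, ∀ X Y : ℂ, ∏ i, (X - α i * Y) =
    X ^ 4 + b * X ^ 3 * Y + c * X ^ 2 * Y ^ 2 + d * X * Y ^ 3 + e * Y ^ 4) ∧
  15625 ≤ ‖(Matrix.vandermonde α).det‖ ∧
  ∃ Z : Finset (ℤ × ℤ), N ≤ Z.card ∧ (∀ z ∈ Z, ‖∏ i, ((z.1 : ℂ) - α i * z.2)‖ = 1) ∧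
    ∀ z ∈ Z, ∀ w ∈ Z, z ≠ w → z.1 * w.2 - w.1 * z.2 ≠ 0

theorem det_vandermonde_moebius (α : Fin 4 → ℂ) {x y u v : ℂ} (hdet : x * v - u * y = 1)
    (hL : ∀ i, x - α i * y ≠ 0) :
    (Matrix.vandermonde fun i => -(u - α i * v) / (x - α i * y)).det * (∏ i, (x - α i * y)) ^ 3
      = (Matrix.vandermonde α).det := by
  have key : ∀ i j, -(u - α i * v) / (x - α i * y) - -(u - α j * v) / (x - α j * y)
      = (α i - α j) / ((x - α i * y) * (x - α j * y)) := by
    intro i j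
    rw [div_sub_div _ _ (hL i) (hL j)]
    congr 1
    linear_combination (α i - α j) * hdet
  rw [det_vandermonde_fin_four, det_vandermonde_fin_four, Fin.prod_univ_four]
  simp only [key]
  have h0 := hL 0
  have h1 := hL 1
  have h2 := hL 2
  have h3 := hL 3
  generalize x - α 0 * y = L₀ at *
  generalize x - α 1 * y = L₁ at *
  generalize x - α 2 * y = L₂ at *
  generalize x - α 3 * y = L₃ at *
  field_simp

theorem IsAdmissible.moebius {N : ℕ} {α : Fin 4 → ℂ} (h : IsAdmissible N α) {x y u v : ℤ}
    (hdet : x * v - u * y = 1) (hsol : ‖∏ i, ((x : ℂ) - α i * y)‖ = 1) :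
    IsAdmissible N fun i => -((u : ℂ) - α i * v) / (x - α i * y) := by
  obtain ⟨⟨b, c, d, e, hf⟩, hD, Z, hN, hZ, hcross⟩ := h
  obtain ⟨b', c', d', e', hsub, -⟩ := exists_quartic_subst 1 b c d e x u y v
  set n := quarticEval 1 b c d e x y with hn
  have hprod : ∏ i, ((x : ℂ) - α i * y) = (n : ℂ) := by
    rw [hf, hn, quarticEval]; push_cast; ring
  have hn1 : |n| = 1 := by
    rw [hprod, Complex.norm_intCast] at hsol
    exact_mod_cast hsol
  have hnn : (n : ℂ) * n = 1 := by
    have : n * n = 1 := by rw [← abs_mul_abs_self, hn1]; norm_num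
    exact_mod_cast this
  have hL : ∀ i, (x : ℂ) - α i * y ≠ 0 := by
    intro i hi
    have : ∏ i, ((x : ℂ) - α i * y) = 0 := Finset.prod_eq_zero (Finset.mem_univ i) hi
    rw [this] at hsol
    simp at hsol
  have hdetC : (x : ℂ) * v - u * y = 1 := by exact_mod_cast hdet
  have hform : ∀ X Y : ℂ, ∏ i, (X - -((u : ℂ) - α i * v) / (x - α i * y) * Y)
      = n * ∏ i, ((x * X + u * Y) - α i * (y * X + v * Y)) := by
    intro X Y
    have : ∏ i, ((x * X + u * Y) - α i * (y * X + v * Y))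
        = (∏ i, ((x : ℂ) - α i * y)) * ∏ i, (X - -((u : ℂ) - α i * v) / (x - α i * y) * Y) := by
      rw [← Finset.prod_mul_distrib]
      refine Finset.prod_congr rfl fun i _ => ?_
      have := hL i
      field_simp
      ring
    rw [this, hprod, ← mul_assoc, hnn, one_mul]
  refine ⟨⟨n * b', n * c', n * d', n * e', fun X Y => ?_⟩, ?_, ?_⟩
  · have h2 := hsub ℂ X Y
    rw [hform, hf]
    push_cast at h2 ⊢
    rw [one_mul] at h2
    rw [h2]
    linear_combination X ^ 4 * hnn
  · have h3 := congrArg norm (det_vandermonde_moebius α hdetC hL)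
    rw [norm_mul, norm_pow, hsol, one_pow, mul_one] at h3
    rw [h3]
    exact hD
  · have hcr : ∀ z w : ℤ × ℤ, (v * z.1 - u * z.2) * (-y * w.1 + x * w.2)
        - (v * w.1 - u * w.2) * (-y * z.1 + x * z.2) = z.1 * w.2 - w.1 * z.2 := by
      intro z w
      linear_combination (z.1 * w.2 - w.1 * z.2) * hdet
    have hinj : Set.InjOn (fun z : ℤ × ℤ => (v * z.1 - u * z.2, -y * z.1 + x * z.2)) Z := by
      intro z hz w hw hzw
      by_contra hne
      apply hcross z hz w hw hne
      simp only [Prod.mk.injEq] at hzw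
      rw [← hcr, hzw.1, hzw.2, sub_self]
    refine ⟨Z.image fun z => (v * z.1 - u * z.2, -y * z.1 + x * z.2), ?_, ?_, ?_⟩
    · rwa [Finset.card_image_of_injOn hinj]
    · intro w hw
      obtain ⟨z, hz, rfl⟩ := Finset.mem_image.1 hw
      rw [hform, norm_mul, Complex.norm_intCast]
      have e1 : (x : ℂ) * ((v * z.1 - u * z.2 : ℤ) : ℂ) + u * ((-y * z.1 + x * z.2 : ℤ) : ℂ)
          = z.1 := by
        push_cast
        linear_combination (z.1 : ℂ) * hdetC
      have e2 : (y : ℂ) * ((v * z.1 - u * z.2 : ℤ) : ℂ) + v * ((-y * z.1 + x * z.2 : ℤ) : ℂ)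
          = z.2 := by
        push_cast
        linear_combination (z.2 : ℂ) * hdetC
      simp only [e1, e2]
      rw [hZ z hz, mul_one]
      exact_mod_cast hn1
    · intro w hw w' hw' hne
      obtain ⟨z, hz, rfl⟩ := Finset.mem_image.1 hw
      obtain ⟨z', hz', rfl⟩ := Finset.mem_image.1 hw'
      simp only
      rw [hcr]
      exact hcross z hz z' hz' fun hzz => hne (by rw [hzz])

theorem isCoprime_of_abs_quarticEval_eq_one {a b c d e x y : ℤ}
    (h : |quarticEval a b c d e x y| = 1) : IsCoprime x y := by
  have hnn : quarticEval a b c d e x y * quarticEval a b c d e x y = 1 := by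
    rw [← abs_mul_abs_self, h]; norm_num
  refine ⟨quarticEval a b c d e x y * (a * x ^ 3 + b * x ^ 2 * y + c * x * y ^ 2 + d * y ^ 3),
    quarticEval a b c d e x y * (e * y ^ 3), ?_⟩
  rw [← hnn, quarticEval]
  ring

theorem IsAdmissible.exists_scaledHeight_le {N : ℕ} {α : Fin 4 → ℂ} (h : IsAdmissible N α)
    {x y : ℤ} (hy : y ≠ 0) (hsol : ‖∏ i, ((x : ℂ) - α i * y)‖ = 1) :
    ∃ β, IsAdmissible N β ∧
      scaledHeight β ≤ ∏ i, max 1 (1 / (|(y : ℝ)| * ‖(x : ℂ) - α i * y‖) / 2) := by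
  obtain ⟨b, c, d, e, hf⟩ := h.1
  have hco : IsCoprime x y := by
    apply isCoprime_of_abs_quarticEval_eq_one (a := 1) (b := b) (c := c) (d := d) (e := e)
    have hprod : ∏ i, ((x : ℂ) - α i * y) = (quarticEval 1 b c d e x y : ℤ) := by
      rw [hf, quarticEval]; push_cast; ring
    rw [hprod, Complex.norm_intCast] at hsol
    exact_mod_cast hsol
  obtain ⟨v₀, u₀, huv⟩ := hco
  set k : ℤ := round ((v₀ : ℝ) / y) with hk
  have hdet : x * (v₀ - k * y) - (-u₀ - k * x) * y = 1 := by linear_combination huv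
  refine ⟨_, h.moebius hdet hsol, ?_⟩
  refine Finset.prod_le_prod (fun i _ => by positivity) fun i _ => ?_
  have hL : (x : ℂ) - α i * y ≠ 0 := by
    intro hi
    have : ∏ i, ((x : ℂ) - α i * y) = 0 := Finset.prod_eq_zero (Finset.mem_univ i) hi
    rw [this] at hsol
    simp at hsol
  have hyC : (y : ℂ) ≠ 0 := by exact_mod_cast hy
  have hdetC : (x : ℂ) * ((v₀ - k * y : ℤ) : ℂ) - ((-u₀ - k * x : ℤ) : ℂ) * y = 1 := by
    exact_mod_cast hdet
  have hβ : -(((-u₀ - k * x : ℤ) : ℂ) - α i * ((v₀ - k * y : ℤ) : ℂ)) / (x - α i * y)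
      = 1 / (y * (x - α i * y)) - (((v₀ : ℝ) / y - k : ℝ) : ℂ) := by
    have : (((v₀ : ℝ) / y - k : ℝ) : ℂ) = ((v₀ - k * y : ℤ) : ℂ) / y := by
      push_cast; field_simp
    rw [this]
    generalize ((v₀ - k * y : ℤ) : ℂ) = v at *
    generalize ((-u₀ - k * x : ℤ) : ℂ) = u at *
    field_simp
    linear_combination hdetC
  beta_reduce
  rw [hβ]
  set t := 1 / (|(y : ℝ)| * ‖(x : ℂ) - α i * y‖) with ht
  have hn : ‖1 / ((y : ℂ) * (x - α i * y)) - (((v₀ : ℝ) / y - k : ℝ) : ℂ)‖ ≤ t + 1 / 2 := by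
    refine (norm_sub_le _ _).trans (add_le_add ?_ ?_)
    · rw [norm_div, norm_one, norm_mul, Complex.norm_intCast]
    · rw [Complex.norm_real, Real.norm_eq_abs]
      exact abs_sub_round _
  rcases le_total t 2 with h2 | h2
  · rw [max_eq_left (by linarith)]
    exact le_max_left _ _
  · exact max_le (le_max_left _ _) (le_max_of_le_right (by linarith))

/-- A chain in which each step multiplies `h` by at least `g` has a small product of steps. -/
theorem exists_prod_erase_le {ι : Type*} [DecidableEq ι] (C : Finset ι) (g h : ι → ℝ)
    (h1 : ∀ z ∈ C, 1 ≤ h z) (hg : ∀ z ∈ C, 0 ≤ g z)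
    (hC : ∀ z ∈ C, ∀ w ∈ C, z ≠ w → h z ≤ h w → g z * h z ≤ h w) (hne : C.Nonempty) :
    ∃ m ∈ C, ∏ z ∈ C.erase m, g z ≤ h m := by
  induction C using Finset.induction_on_max_value h with
  | empty => exact absurd hne Finset.not_nonempty_empty
  | insert a s ha hmax ih =>
    refine ⟨a, Finset.mem_insert_self a s, ?_⟩
    rw [Finset.erase_insert ha]
    rcases s.eq_empty_or_nonempty with rfl | hs
    · simpa using h1 a (Finset.mem_insert_self _ _)
    · obtain ⟨m, hm, hle⟩ := ih (fun z hz => h1 z (Finset.mem_insert_of_mem hz))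
        (fun z hz => hg z (Finset.mem_insert_of_mem hz))
        (fun z hz w hw => hC z (Finset.mem_insert_of_mem hz) w (Finset.mem_insert_of_mem hw)) hs
      rw [← Finset.mul_prod_erase s g hm]
      calc g m * ∏ z ∈ s.erase m, g z ≤ g m * h m :=
            mul_le_mul_of_nonneg_left hle (hg m (Finset.mem_insert_of_mem hm))
        _ ≤ h a := hC m (Finset.mem_insert_of_mem hm) a (Finset.mem_insert_self _ _)
            (fun hma => ha (hma ▸ hm)) (hmax m hm)

theorem exists_prod_sdiff_le {ι : Type*} [DecidableEq ι] (C : Finset ι) (g h : ι → ℝ) {Y : ℝ}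
    (hY : 1 ≤ Y) (h1 : ∀ z ∈ C, 1 ≤ h z) (hhY : ∀ z ∈ C, h z ≤ Y) (hg : ∀ z ∈ C, 0 ≤ g z)
    (hC : ∀ z ∈ C, ∀ w ∈ C, z ≠ w → h z ≤ h w → g z * h z ≤ h w) :
    ∃ m : Finset ι, m.card ≤ 1 ∧ ∏ z ∈ C \ m, g z ≤ Y := by
  rcases C.eq_empty_or_nonempty with rfl | hs
  · exact ⟨∅, by simp, by simpa using hY⟩
  · obtain ⟨m, hm, hle⟩ := exists_prod_erase_le C g h h1 hg hC hs
    exact ⟨{m}, by simp, by rw [Finset.sdiff_singleton_eq_erase]; exact hle.trans (hhY m hm)⟩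

theorem one_le_norm_mul_add_norm_mul (a : ℂ) {x y x' y' : ℤ} (h : x * y' - x' * y ≠ 0) :
    1 ≤ ‖(x : ℂ) - a * y‖ * |(y' : ℝ)| + ‖(x' : ℂ) - a * y'‖ * |(y : ℝ)| := by
  have h1 : (1 : ℝ) ≤ |((x * y' - x' * y : ℤ) : ℝ)| := by exact_mod_cast Int.one_le_abs h
  have h2 : ((x * y' - x' * y : ℤ) : ℂ) = (x - a * y) * y' - (x' - a * y') * y := by
    push_cast; ring
  have h3 := norm_sub_le (((x : ℂ) - a * y) * y') ((x' - a * y') * y)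
  rw [← h2, norm_mul, norm_mul, Complex.norm_intCast, Complex.norm_intCast,
    Complex.norm_intCast] at h3
  exact h1.trans h3

theorem pow_card_sub_four_le {α : Fin 4 → ℂ} {S : Finset (ℤ × ℤ)} {ρ Y : ℝ} (hY : 1 ≤ Y)
    (hρ : 1 ≤ ρ) (hy : ∀ z ∈ S, z.2 ≠ 0) (hyY : ∀ z ∈ S, |(z.2 : ℝ)| ≤ Y)
    (hL : ∀ z ∈ S, ∀ i, (z.1 : ℂ) - α i * z.2 ≠ 0)
    (hS : ∀ z ∈ S, ρ ≤ ∏ i, max 1 (1 / (|(z.2 : ℝ)| * ‖(z.1 : ℂ) - α i * z.2‖) / 2))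
    (hcross : ∀ z ∈ S, ∀ w ∈ S, z ≠ w → z.1 * w.2 - w.1 * z.2 ≠ 0) :
    ρ ^ (S.card - 4) ≤ Y ^ 4 := by
  set u : Fin 4 → ℤ × ℤ → ℝ := fun i z => 1 / (|(z.2 : ℝ)| * ‖(z.1 : ℂ) - α i * z.2‖) with hu
  have hypos : ∀ z ∈ S, 1 ≤ |(z.2 : ℝ)| := fun z hz => by exact_mod_cast Int.one_le_abs (hy z hz)
  have key : ∀ i, ∃ m : Finset (ℤ × ℤ), m.card ≤ 1 ∧
      ∏ z ∈ (S.filter fun z => 2 < u i z) \ m, u i z / 2 ≤ Y := by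
    intro i
    refine exists_prod_sdiff_le _ _ (fun z => |(z.2 : ℝ)|) hY
      (fun z hz => hypos z (Finset.mem_filter.1 hz).1)
      (fun z hz => hyY z (Finset.mem_filter.1 hz).1) (fun z _ => by positivity) ?_
    intro z hz w hw hne hle
    obtain ⟨hz, hz2⟩ := Finset.mem_filter.1 hz
    obtain ⟨hw, hw2⟩ := Finset.mem_filter.1 hw
    have h1 := one_le_norm_mul_add_norm_mul (α i) (hcross z hz w hw hne)
    have hyz := hypos z hz
    have hyw := hypos w hw
    have hLz : 0 < ‖(z.1 : ℂ) - α i * z.2‖ := norm_pos_iff.2 (hL z hz i)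
    have hLw : 0 < ‖(w.1 : ℂ) - α i * w.2‖ := norm_pos_iff.2 (hL w hw i)
    simp only [hu] at hw2 ⊢
    rw [lt_div_iff₀ (by positivity)] at hw2
    have h2 : ‖(w.1 : ℂ) - α i * w.2‖ * |(z.2 : ℝ)| ≤ ‖(w.1 : ℂ) - α i * w.2‖ * |(w.2 : ℝ)| := by
      gcongr
    have h3 : 1 ≤ 2 * (‖(z.1 : ℂ) - α i * z.2‖ * |(w.2 : ℝ)|) := by linarith
    generalize |(z.2 : ℝ)| = a at *
    generalize ‖(z.1 : ℂ) - α i * z.2‖ = b at *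
    have : 1 / (a * b) / 2 * a = 1 / (2 * b) := by field_simp
    rw [this, div_le_iff₀ (by positivity)]
    linarith
  choose m hm1 hm2 using key
  set R := S \ Finset.univ.biUnion m with hR
  have hRcard : S.card - 4 ≤ R.card := by
    have h1 : (Finset.univ.biUnion m).card ≤ 4 :=
      Finset.card_biUnion_le.trans ((Finset.sum_le_sum fun i _ => hm1 i).trans (by simp))
    have := Finset.le_card_sdiff (Finset.univ.biUnion m) S
    rw [← hR] at this
    omega
  calc ρ ^ (S.card - 4) ≤ ρ ^ R.card := pow_le_pow_right₀ hρ hRcard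
    _ = ∏ z ∈ R, ρ := by simp
    _ ≤ ∏ z ∈ R, ∏ i, max 1 (u i z / 2) :=
        Finset.prod_le_prod (fun _ _ => by linarith)
          fun z hz => hS z (Finset.mem_sdiff.1 hz).1
    _ = ∏ i, ∏ z ∈ R, max 1 (u i z / 2) := Finset.prod_comm
    _ ≤ ∏ i : Fin 4, Y := by
        refine Finset.prod_le_prod
          (fun i _ => Finset.prod_nonneg fun z _ => by positivity) fun i _ => ?_
        refine le_trans ?_ (hm2 i)
        rw [← Finset.prod_filter_mul_prod_filter_not R fun z => 2 < u i z]
        have h1 : ∏ z ∈ R.filter fun z => ¬ 2 < u i z, max 1 (u i z / 2) = 1 := by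
          refine Finset.prod_eq_one fun z hz => max_eq_left ?_
          have := (Finset.mem_filter.1 hz).2
          linarith
        have h2 : ∏ z ∈ R.filter fun z => 2 < u i z, max 1 (u i z / 2)
            = ∏ z ∈ R.filter fun z => 2 < u i z, u i z / 2 := by
          refine Finset.prod_congr rfl fun z hz => max_eq_right ?_
          have := (Finset.mem_filter.1 hz).2
          linarith
        rw [h1, mul_one, h2]
        refine Finset.prod_le_prod_of_subset_of_one_le ?_ (fun z _ => by positivity) ?_
        · intro z hz
          obtain ⟨hz, hz2⟩ := Finset.mem_filter.1 hz
          obtain ⟨hz, hz3⟩ := Finset.mem_sdiff.1 hz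
          refine Finset.mem_sdiff.2 ⟨Finset.mem_filter.2 ⟨hz, hz2⟩, fun h => hz3 ?_⟩
          exact Finset.mem_biUnion.2 ⟨i, Finset.mem_univ i, h⟩
        · intro z hz _
          have := (Finset.mem_filter.1 (Finset.mem_sdiff.1 hz).1).2
          linarith
    _ = Y ^ 4 := by simp

theorem exists_max_pow_le {ι : Type*} (W : ι → ℝ) {B : ℝ} (hB : 1 ≤ B) (n : ℕ) (G : Finset ι)
    (hG : n < G.card) (hW : ∀ z ∈ G, B ≤ W z)
    (hgap : ∀ z ∈ G, ∀ w ∈ G, z ≠ w → W z ≤ W w → W z ^ 3 ≤ W w) :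
    ∃ m ∈ G, (∀ z ∈ G, W z ≤ W m) ∧ B ^ 3 ^ n ≤ W m := by
  classical
  induction n generalizing G with
  | zero =>
    obtain ⟨m, hm, hmax⟩ := G.exists_max_image W (Finset.card_pos.1 hG)
    exact ⟨m, hm, hmax, by simpa using hW m hm⟩
  | succ n ih =>
    obtain ⟨m, hm, hmax⟩ := G.exists_max_image W (Finset.card_pos.1 (by omega))
    obtain ⟨k, hk, -, hkW⟩ := ih (G.erase m) (by rw [Finset.card_erase_of_mem hm]; omega)
      (fun z hz => hW z (Finset.mem_of_mem_erase hz))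
      (fun z hz w hw => hgap z (Finset.mem_of_mem_erase hz) w (Finset.mem_of_mem_erase hw))
    refine ⟨m, hm, hmax, ?_⟩
    obtain ⟨hkm, hkG⟩ := Finset.mem_erase.1 hk
    calc B ^ 3 ^ (n + 1) = (B ^ 3 ^ n) ^ 3 := by rw [← pow_mul, pow_succ]
      _ ≤ W k ^ 3 := by gcongr
      _ ≤ W m := hgap k hkG m hm hkm (hmax k hkG)

theorem gap_principle {a : ℂ} {M : ℝ} (hM : 1 ≤ M) {x y x' y' : ℤ}
    (h : x * y' - x' * y ≠ 0) (hle : |(y : ℝ)| ≤ |(y' : ℝ)|) (hy : M ≤ |(y : ℝ)|)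
    (hz : ‖(x : ℂ) - a * y‖ * |(y : ℝ)| ^ 3 ≤ M ^ 2 / 24)
    (hz' : ‖(x' : ℂ) - a * y'‖ * |(y' : ℝ)| ^ 3 ≤ M ^ 2 / 24) :
    23 * |(y : ℝ)| ^ 3 ≤ M ^ 2 * |(y' : ℝ)| := by
  have h1 := one_le_norm_mul_add_norm_mul a h
  generalize |(y : ℝ)| = s at *
  generalize |(y' : ℝ)| = t at *
  generalize ‖(x : ℂ) - a * y‖ = p at *
  generalize ‖(x' : ℂ) - a * y'‖ = q at *
  have hs : 0 < s := by linarith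
  have ht : 0 < t := by linarith
  have h2 : q * s ≤ 1 / 24 := by
    have e1 : (q * s) * t ^ 3 ≤ 1 / 24 * t ^ 3 := by
      calc (q * s) * t ^ 3 = q * t ^ 3 * s := by ring
        _ ≤ M ^ 2 / 24 * t := by gcongr
        _ ≤ t ^ 2 / 24 * t := by gcongr; linarith
        _ = _ := by ring
    exact le_of_mul_le_mul_right e1 (by positivity)
  have h3 : 23 / 24 * s ^ 3 ≤ (p * t) * s ^ 3 := by gcongr; linarith
  have h4 : p * s ^ 3 * t ≤ M ^ 2 / 24 * t := by gcongr
  linarith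

theorem pow_le_of_pow_le_mul_sq {p q ν Q : ℝ} (hp : 0 ≤ p) (hpq : p ^ 5 ≤ q ^ 9) (hq : 1 ≤ q)
    (hν : 1 ≤ ν) (hQ : 0 ≤ Q) (h : (q * ν ^ 4) ^ 3 ^ 8 ≤ q * Q ^ 2 / (ν ^ 5) ^ 2) :
    (p * ν ^ 5) ^ 1800 ≤ Q := by
  have hq0 : 0 < q := by linarith
  have hν0 : 0 < ν := by linarith
  have h1 : q ^ 6560 * ν ^ 26254 ≤ Q ^ 2 := by
    rw [le_div_iff₀ (by positivity)] at h
    have e : (q * ν ^ 4) ^ 3 ^ 8 * (ν ^ 5) ^ 2 = q * (q ^ 6560 * ν ^ 26254) := by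
      rw [show 3 ^ 8 = 6561 by norm_num]
      ring
    rw [e] at h
    exact le_of_mul_le_mul_left h hq0
  refine le_of_sq_le_sq ?_ hQ
  calc ((p * ν ^ 5) ^ 1800) ^ 2 = (p ^ 5) ^ 720 * ν ^ 18000 := by ring
    _ ≤ (q ^ 9) ^ 720 * ν ^ 18000 := by gcongr
    _ = q ^ 6480 * ν ^ 18000 := by ring
    _ ≤ q ^ 6560 * ν ^ 26254 := by
        gcongr <;> norm_num
    _ ≤ Q ^ 2 := h1

theorem IsAdmissible.exists_near_minimal {N : ℕ} {α₀ : Fin 4 → ℂ} (h : IsAdmissible N α₀) :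
    ∃ α, IsAdmissible N α ∧
      ∀ β, IsAdmissible N β → scaledHeight α / (51 / 50) ≤ scaledHeight β := by
  set A := scaledHeight '' {β | IsAdmissible N β} with hA
  have hne : A.Nonempty := ⟨_, α₀, h, rfl⟩
  have hlb : ∀ t ∈ A, 1 ≤ t := by
    rintro _ ⟨β, -, rfl⟩
    exact one_le_scaledHeight β
  have h1 : 1 ≤ sInf A := le_csInf hne hlb
  obtain ⟨_, ⟨α, hα, rfl⟩, hlt⟩ := exists_lt_of_csInf_lt hne
    (show sInf A < sInf A * (51 / 50) by linarith)
  refine ⟨α, hα, fun β hβ => ?_⟩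
  have h2 : sInf A ≤ scaledHeight β := csInf_le ⟨1, hlb⟩ ⟨β, hβ, rfl⟩
  rw [div_le_iff₀ (by norm_num)]
  linarith

theorem linear_factor_ne_zero {α : Fin 4 → ℂ} {x y : ℤ} (h : ‖∏ i, ((x : ℂ) - α i * y)‖ = 1)
    (i : Fin 4) : (x : ℂ) - α i * y ≠ 0 := by
  intro hi
  rw [Finset.prod_eq_zero (Finset.mem_univ i) hi] at h
  simp at h

theorem card_small_solutions_le {N : ℕ} {α : Fin 4 → ℂ} {ν : ℝ} (hν1 : 1 ≤ ν)
    (hν : ν ^ 5 = scaledHeight α) (hD : 15625 ≤ ‖(Matrix.vandermonde α).det‖)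
    (hmin : ∀ β, IsAdmissible N β → scaledHeight α / (51 / 50) ≤ scaledHeight β)
    (hα : IsAdmissible N α) {S : Finset (ℤ × ℤ)} (hy : ∀ z ∈ S, z.2 ≠ 0)
    (hsol : ∀ z ∈ S, ‖∏ i, ((z.1 : ℂ) - α i * z.2)‖ = 1)
    (hyY : ∀ z ∈ S, |(z.2 : ℝ)| ≤ ν ^ 7)
    (hcross : ∀ z ∈ S, ∀ w ∈ S, z ≠ w → z.1 * w.2 - w.1 * z.2 ≠ 0) : S.card ≤ 9 := by
  by_contra! hcard
  have h4 := four_le_scaledHeight_pow hD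
  rw [← hν] at h4 hmin
  have hρ : 1 ≤ ν ^ 5 / (51 / 50) := by
    rw [le_div_iff₀ (by norm_num)]
    by_contra! hlt
    have : (ν ^ 5) ^ 3 < (1 * (51 / 50)) ^ 3 := by gcongr
    norm_num at this
    linarith
  have h1 := pow_card_sub_four_le (one_le_pow₀ hν1 : 1 ≤ ν ^ 7) hρ hy hyY
    (fun z hz i => linear_factor_ne_zero (hsol z hz) i) (fun z hz => by
      obtain ⟨β, hβ, hle⟩ := hα.exists_scaledHeight_le (hy z hz) (hsol z hz)
      exact (hmin β hβ).trans hle) hcross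
  have h2 : (ν ^ 5 / (51 / 50)) ^ 6 ≤ (ν ^ 5 / (51 / 50)) ^ (S.card - 4) :=
    pow_le_pow_right₀ hρ (by omega)
  have h3 : ν ^ 28 * ν ^ 2 ≤ ν ^ 28 * (51 / 50) ^ 6 := by
    have := h2.trans h1
    rw [div_pow, div_le_iff₀ (by norm_num)] at this
    linarith
  have h5 : ν ^ 2 ≤ (51 / 50) ^ 6 := le_of_mul_le_mul_left h3 (by positivity)
  have h6 : (ν ^ 2) ^ 15 ≤ ((51 / 50) ^ 6) ^ 15 := by gcongr
  have h7 : (4 : ℝ) ^ 2 ≤ ((ν ^ 5) ^ 3) ^ 2 := by gcongr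
  have h8 : ((ν ^ 5) ^ 3) ^ 2 = (ν ^ 2) ^ 15 := by ring
  norm_num at h6 h7 h8
  linarith

theorem card_large_solutions_le {N : ℕ} {α : Fin 4 → ℂ} {ν : ℝ} (hν1 : 1 ≤ ν)
    (hν : ν ^ 5 = scaledHeight α) (hD : 15625 ≤ ‖(Matrix.vandermonde α).det‖)
    (hmin : ∀ β, IsAdmissible N β → scaledHeight α / (51 / 50) ≤ scaledHeight β)
    (hα : IsAdmissible N α) {Z : Finset (ℤ × ℤ)}
    (hsol : ∀ z ∈ Z, ‖∏ i, ((z.1 : ℂ) - α i * z.2)‖ = 1)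
    (hcross : ∀ z ∈ Z, ∀ w ∈ Z, z ≠ w → z.1 * w.2 - w.1 * z.2 ≠ 0) :
    Z.card ≤ (Z.filter fun z => ν ^ 7 < |(z.2 : ℝ)|).card + 10 := by
  have h1 : (Z.filter fun z => z.2 = 0).card ≤ 1 := by
    refine Finset.card_le_one.2 fun z hz w hw => ?_
    obtain ⟨hz, hz0⟩ := Finset.mem_filter.1 hz
    obtain ⟨hw, hw0⟩ := Finset.mem_filter.1 hw
    by_contra hne
    exact hcross z hz w hw hne (by rw [hz0, hw0]; ring)
  have h2 : (Z.filter fun z => z.2 ≠ 0 ∧ |(z.2 : ℝ)| ≤ ν ^ 7).card ≤ 9 :=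
    card_small_solutions_le hν1 hν hD hmin hα (fun z hz => (Finset.mem_filter.1 hz).2.1)
      (fun z hz => hsol z (Finset.mem_filter.1 hz).1) (fun z hz => (Finset.mem_filter.1 hz).2.2)
      (fun z hz w hw => hcross z (Finset.mem_filter.1 hz).1 w (Finset.mem_filter.1 hw).1)
  have h3 : Z ⊆ (Z.filter fun z => ν ^ 7 < |(z.2 : ℝ)|) ∪ ((Z.filter fun z => z.2 = 0) ∪
      (Z.filter fun z => z.2 ≠ 0 ∧ |(z.2 : ℝ)| ≤ ν ^ 7)) := by
    intro z hz
    simp only [Finset.mem_union, Finset.mem_filter, hz, true_and]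
    rcases lt_or_ge (ν ^ 7) |(z.2 : ℝ)| with h | h
    · exact Or.inl h
    · by_cases h0 : z.2 = 0
      · exact Or.inr (Or.inl h0)
      · exact Or.inr (Or.inr ⟨h0, h⟩)
  have h4 := Finset.card_le_card h3
  have h5 := Finset.card_union_le (Z.filter fun z => ν ^ 7 < |(z.2 : ℝ)|)
    ((Z.filter fun z => z.2 = 0) ∪ (Z.filter fun z => z.2 ≠ 0 ∧ |(z.2 : ℝ)| ≤ ν ^ 7))
  have h6 := Finset.card_union_le (Z.filter fun z => z.2 = 0)
    (Z.filter fun z => z.2 ≠ 0 ∧ |(z.2 : ℝ)| ≤ ν ^ 7)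
  omega

theorem IsAdmissible.exists_large_pair {α₀ : Fin 4 → ℂ} (h : IsAdmissible 47 α₀) :
    ∃ α : Fin 4 → ℂ, IsAdmissible 47 α ∧ ∃ i, ∃ x₀ y₀ x₁ y₁ : ℤ, x₀ * y₁ - x₁ * y₀ ≠ 0 ∧
      IsCoprime x₀ y₀ ∧
      (240 * scaledHeight α) ^ 1800 ≤ |(y₀ : ℝ)| ∧
      |(y₀ : ℝ)| ^ 3 ≤ (240 * scaledHeight α) ^ 2 * |(y₁ : ℝ)| ∧
      ‖(x₀ : ℂ) - α i * y₀‖ * |(y₀ : ℝ)| ^ 3 ≤ (240 * scaledHeight α) ^ 2 ∧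
      ‖(x₁ : ℂ) - α i * y₁‖ * |(y₁ : ℝ)| ^ 3 ≤ (240 * scaledHeight α) ^ 2 := by
  obtain ⟨α, hα, hmin⟩ := h.exists_near_minimal
  refine ⟨α, hα, ?_⟩
  obtain ⟨⟨b, c, d, e, hf⟩, hD, Z, hN, hZ, hcross⟩ := id hα
  have hM := one_le_scaledHeight α
  obtain ⟨ν, hν1, hν⟩ : ∃ ν : ℝ, 1 ≤ ν ∧ ν ^ 5 = scaledHeight α :=
    ⟨scaledHeight α ^ ((5 : ℕ) : ℝ)⁻¹, Real.one_le_rpow hM (by positivity),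
      Real.rpow_inv_natCast_pow (by linarith) (by norm_num)⟩
  have hcard := card_large_solutions_le hν1 hν hD hmin hα hZ hcross
  set G := Z.filter fun z => ν ^ 7 < |(z.2 : ℝ)| with hG
  have hex : ∀ z : ℤ × ℤ, ∃ i : Fin 4, ∀ j,
      ‖(z.1 : ℂ) - α i * z.2‖ ≤ ‖(z.1 : ℂ) - α j * z.2‖ := fun z =>
    Finite.exists_min fun i => ‖(z.1 : ℂ) - α i * z.2‖
  choose r hr using hex
  obtain ⟨i, -, hi⟩ := Finset.exists_lt_card_fiber_of_mul_lt_card_of_maps_to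
    (s := G) (t := (Finset.univ : Finset (Fin 4))) (f := r) (n := 9)
    (fun _ _ => Finset.mem_univ _) (by simp; omega)
  set F := G.filter fun z => r z = i with hF
  have hmem : ∀ z ∈ F, z ∈ Z ∧ ν ^ 7 < |(z.2 : ℝ)| ∧ r z = i := fun z hz =>
    ⟨(Finset.mem_filter.1 (Finset.mem_filter.1 hz).1).1,
      (Finset.mem_filter.1 (Finset.mem_filter.1 hz).1).2, (Finset.mem_filter.1 hz).2⟩
  have hM7 : scaledHeight α ≤ ν ^ 7 := by
    rw [← hν]; exact pow_le_pow_right₀ hν1 (by norm_num)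
  have hL : ∀ z ∈ F, ‖(z.1 : ℂ) - α i * z.2‖ * |(z.2 : ℝ)| ^ 3 ≤ scaledHeight α ^ 2 / 24 := by
    intro z hz
    obtain ⟨hzZ, -, hri⟩ := hmem z hz
    have := norm_linear_factor_mul_le hD (hZ z hzZ) (i := i) (by rw [← hri]; exact hr z)
    simpa using this
  have hgap : ∀ z ∈ F, ∀ w ∈ F, z ≠ w → |(z.2 : ℝ)| ≤ |(w.2 : ℝ)| →
      23 * |(z.2 : ℝ)| ^ 3 ≤ scaledHeight α ^ 2 * |(w.2 : ℝ)| := fun z hz w hw hne hle =>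
    gap_principle hM (hcross z (hmem z hz).1 w (hmem w hw).1 hne) hle
      (hM7.trans (hmem z hz).2.1.le) (hL z hz) (hL w hw)
  obtain ⟨w, hw, hwmax⟩ := F.exists_max_image (fun z => |(z.2 : ℝ)|) (Finset.card_pos.1 (by omega))
  obtain ⟨z, hz, -, hzW⟩ := exists_max_pow_le
    (fun z : ℤ × ℤ => 23 * |(z.2 : ℝ)| ^ 2 / (ν ^ 5) ^ 2) (B := 23 * ν ^ 4)
    (by nlinarith [one_le_pow₀ hν1 (n := 4)]) 8 (F.erase w)
    (by rw [Finset.card_erase_of_mem hw]; omega)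
    (by
      intro z hz
      have h1 := (hmem z (Finset.mem_of_mem_erase hz)).2.1
      rw [le_div_iff₀ (by positivity)]
      calc 23 * ν ^ 4 * (ν ^ 5) ^ 2 = 23 * (ν ^ 7) ^ 2 := by ring
        _ ≤ _ := by gcongr)
    (by
      intro z hz w hw hne hle
      have hle' : |(z.2 : ℝ)| ≤ |(w.2 : ℝ)| := by
        rw [div_le_div_iff_of_pos_right (by positivity)] at hle
        exact le_of_sq_le_sq (by linarith) (abs_nonneg _)
      have h1 := hgap z (Finset.mem_of_mem_erase hz) w (Finset.mem_of_mem_erase hw) hne hle'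
      rw [← hν] at h1
      have h2 : (23 * |(z.2 : ℝ)| ^ 3) ^ 2 ≤ ((ν ^ 5) ^ 2 * |(w.2 : ℝ)|) ^ 2 := by gcongr
      rw [div_pow, div_le_div_iff₀ (by positivity) (by positivity)]
      generalize |(z.2 : ℝ)| = s at *
      generalize |(w.2 : ℝ)| = t at *
      calc (23 * s ^ 2) ^ 3 * (ν ^ 5) ^ 2 = 23 * (ν ^ 5) ^ 2 * (23 * s ^ 3) ^ 2 := by ring
        _ ≤ 23 * (ν ^ 5) ^ 2 * ((ν ^ 5) ^ 2 * t) ^ 2 := by gcongr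
        _ = 23 * t ^ 2 * ((ν ^ 5) ^ 2) ^ 3 := by ring)
  obtain ⟨hzw, hzF⟩ := Finset.mem_erase.1 hz
  have hlast : ∀ z ∈ F, ‖(z.1 : ℂ) - α i * z.2‖ * |(z.2 : ℝ)| ^ 3 ≤ (240 * scaledHeight α) ^ 2 :=
    fun z hz => (hL z hz).trans (by nlinarith)
  refine ⟨i, z.1, z.2, w.1, w.2, hcross z (hmem z hzF).1 w (hmem w hw).1 hzw, ?_, ?_, ?_,
    hlast z hzF, hlast w hw⟩
  · apply isCoprime_of_abs_quarticEval_eq_one (a := 1) (b := b) (c := c) (d := d) (e := e)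
    have hprod : ∏ i, ((z.1 : ℂ) - α i * z.2) = (quarticEval 1 b c d e z.1 z.2 : ℤ) := by
      rw [hf, quarticEval]; push_cast; ring
    have := hZ z (hmem z hzF).1
    rw [hprod, Complex.norm_intCast] at this
    exact_mod_cast this
  · rw [← hν]
    exact pow_le_of_pow_le_mul_sq (by norm_num) (by norm_num) (by norm_num) hν1 (abs_nonneg _) hzW
  · have h1 := hgap z hzF w hw hzw (hwmax z hzF)
    have h2 : scaledHeight α ^ 2 * |(w.2 : ℝ)| ≤ (240 * scaledHeight α) ^ 2 * |(w.2 : ℝ)| := by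
      gcongr; linarith
    have h3 : 0 ≤ |(z.2 : ℝ)| ^ 3 := by positivity
    linarith

attribute [local instance] Matrix.seminormedAddCommGroup in
/-- Siegel's lemma with an entrywise bound and an integral upper bound for the exponent. -/
theorem exists_ne_zero_int_vec_abs_le {ι κ : Type*} [Fintype ι] [Fintype κ] (A : Matrix ι κ ℤ)
    {c : ℝ} (hc : 1 ≤ c) (hA : ∀ i j, |(A i j : ℝ)| ≤ c) (hcard : Fintype.card ι < Fintype.card κ)
    (hι : 0 < Fintype.card ι) {E : ℕ}
    (hE : Fintype.card ι ≤ E * (Fintype.card κ - Fintype.card ι)) :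
    ∃ t : κ → ℤ, t ≠ 0 ∧ A.mulVec t = 0 ∧ ∀ j, |(t j : ℝ)| ≤ (Fintype.card κ * c) ^ E := by
  obtain ⟨t, ht0, ht, hn⟩ := Int.Matrix.exists_ne_zero_int_vec_norm_le A hcard hι
  refine ⟨t, ht0, ht, fun j => ?_⟩
  have h1 : ‖A‖ ≤ c := (Matrix.norm_le_iff (by linarith)).2 fun i j => by
    rw [Int.norm_eq_abs]; exact hA i j
  have h2 : |(t j : ℝ)| ≤ ‖t‖ := by
    rw [← Int.norm_eq_abs]; exact norm_le_pi_norm t j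
  have hκ : (1 : ℝ) ≤ Fintype.card κ := by exact_mod_cast (by omega)
  have hpos : (0 : ℝ) < Fintype.card κ - Fintype.card ι := by
    rw [sub_pos]; exact_mod_cast hcard
  have h3 : (Fintype.card ι : ℝ) / (Fintype.card κ - Fintype.card ι) ≤ E := by
    rw [div_le_iff₀ hpos, ← Nat.cast_sub hcard.le]
    exact_mod_cast hE
  calc |(t j : ℝ)| ≤ _ := h2.trans hn
    _ ≤ (Fintype.card κ * c) ^ ((Fintype.card ι : ℝ) / (Fintype.card κ - Fintype.card ι)) := by
        apply Real.rpow_le_rpow (by positivity) _ (by positivity)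
        gcongr
        exact max_le hc h1
    _ ≤ (Fintype.card κ * c) ^ (E : ℝ) :=
        Real.rpow_le_rpow_of_exponent_le (by nlinarith) h3
    _ = _ := Real.rpow_natCast _ _

/-- The coefficients of `X ^ n` modulo `X ^ 4 + b X ^ 3 + c X ^ 2 + d X + e`. -/
def powModCoeff (b c d e : ℤ) : ℕ → Fin 4 → ℤ
  | 0 => ![1, 0, 0, 0]
  | n + 1 => let r := powModCoeff b c d e n
    ![-e * r 3, r 0 - d * r 3, r 1 - c * r 3, r 2 - b * r 3]

theorem pow_eq_sum_powModCoeff {b c d e : ℤ} {a : ℂ}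
    (ha : a ^ 4 + b * a ^ 3 + c * a ^ 2 + d * a + e = 0) (n : ℕ) :
    a ^ n = ∑ l, (powModCoeff b c d e n l : ℂ) * a ^ (l : ℕ) := by
  induction n with
  | zero => simp [powModCoeff, Fin.sum_univ_four]
  | succ n ih =>
    rw [pow_succ, ih]
    simp only [powModCoeff, Fin.sum_univ_four]
    simp
    linear_combination (powModCoeff b c d e n 3 : ℂ) * ha

theorem abs_powModCoeff_le {b c d e : ℤ} {K : ℝ} (hb : 1 + |(b : ℝ)| ≤ K) (hc : 1 + |(c : ℝ)| ≤ K)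
    (hd : 1 + |(d : ℝ)| ≤ K) (he : 1 + |(e : ℝ)| ≤ K) (n : ℕ) (l : Fin 4) :
    |(powModCoeff b c d e n l : ℝ)| ≤ K ^ n := by
  induction n generalizing l with
  | zero => fin_cases l <;> simp [powModCoeff]
  | succ n ih =>
    have h3 := ih 3
    have key : ∀ p u : ℝ, 1 + |p| ≤ K → |u| ≤ K ^ n →
        |u - p * (powModCoeff b c d e n 3 : ℝ)| ≤ K ^ (n + 1) := by
      intro p u hp hu
      have hK : 0 ≤ K ^ n := (abs_nonneg _).trans h3
      calc |u - p * (powModCoeff b c d e n 3 : ℝ)|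
          ≤ |u| + |p| * |(powModCoeff b c d e n 3 : ℝ)| := by
            rw [← abs_mul]; exact abs_sub _ _
        _ ≤ K ^ n + |p| * K ^ n := by gcongr
        _ = K ^ n * (1 + |p|) := by ring
        _ ≤ K ^ n * K := by gcongr
        _ = K ^ (n + 1) := by ring
    have hK : 0 ≤ K ^ n := (abs_nonneg _).trans h3
    fin_cases l
    · simpa [powModCoeff] using key e 0 he (by simpa using hK)
    · simpa [powModCoeff] using key d _ hd (ih 0)
    · simpa [powModCoeff] using key c _ hc (ih 1)
    · simpa [powModCoeff] using key b _ hb (ih 2)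

open Polynomial in
theorem exists_auxiliary_polynomials {b c d e : ℤ} {K : ℝ} (hK : 256 ≤ K)
    (hb : 1 + |(b : ℝ)| ≤ K) (hc : 1 + |(c : ℝ)| ≤ K) (hd : 1 + |(d : ℝ)| ≤ K)
    (he : 1 + |(e : ℝ)| ≤ K) {s : ℕ} (hs : 1 ≤ s) :
    ∃ A B : ℤ[X], (A ≠ 0 ∨ B ≠ 0) ∧ A.natDegree ≤ 5 * s + 3 ∧ B.natDegree ≤ 5 * s + 3 ∧
      (∀ j, |(A.coeff j : ℝ)| ≤ K ^ (88 * s)) ∧ (∀ j, |(B.coeff j : ℝ)| ≤ K ^ (88 * s)) ∧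
      ∀ a : ℂ, a ^ 4 + b * a ^ 3 + c * a ^ 2 + d * a + e = 0 → ∀ k < 2 * s + 2,
        (taylor a (A.map (Int.castRingHom ℂ) - C a * B.map (Int.castRingHom ℂ))).coeff k = 0 := by
  set m := 5 * s + 3 with hm
  set w := powModCoeff b c d e with hw
  let T : Matrix (Fin (2 * s + 2) × Fin 4) (Fin (m + 1) ⊕ Fin (m + 1)) ℤ := fun kl =>
    Sum.elim (fun i => (Nat.choose i kl.1 : ℤ) * w (i - kl.1) kl.2)
      (fun i => -((Nat.choose i kl.1 : ℤ) * w (i - kl.1 + 1) kl.2))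
  have hK1 : 1 ≤ K := by linarith
  have hentry : ∀ (i : Fin (m + 1)) (k n : ℕ) (l : Fin 4), n ≤ m + 1 →
      |(Nat.choose i k : ℝ) * (w n l : ℝ)| ≤ 2 ^ m * K ^ (m + 1) := by
    intro i k n l hn
    rw [abs_mul, Nat.abs_cast]
    have h1 : (Nat.choose i k : ℝ) ≤ 2 ^ m := by
      have h2 : Nat.choose i k ≤ 2 ^ m :=
        (Nat.choose_le_two_pow _ _).trans (Nat.pow_le_pow_right (by norm_num) (by omega))
      exact_mod_cast h2
    have h2 : |(w n l : ℝ)| ≤ K ^ (m + 1) :=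
      (abs_powModCoeff_le hb hc hd he n l).trans (pow_le_pow_right₀ hK1 hn)
    gcongr
  have hcard1 : Fintype.card (Fin (2 * s + 2) × Fin 4) = 8 * s + 8 := by simp; ring
  have hcard2 : Fintype.card (Fin (m + 1) ⊕ Fin (m + 1)) = 10 * s + 8 := by simp; omega
  obtain ⟨t, ht0, ht, hbound⟩ := exists_ne_zero_int_vec_abs_le T (c := 2 ^ m * K ^ (m + 1))
    (one_le_mul_of_one_le_of_one_le (one_le_pow₀ (by norm_num)) (one_le_pow₀ hK1))
    (by
      rintro ⟨k, l⟩ (i | i)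
      · have := hentry i k (i - k) l (by omega)
        simpa [T] using this
      · have := hentry i k (i - k + 1) l (by omega)
        simpa [T] using this)
    (by rw [hcard1, hcard2]; omega) (by rw [hcard1]; omega) (E := 8)
    (by rw [hcard1, hcard2]; omega)
  have hsize : ∀ j, |(t j : ℝ)| ≤ K ^ (88 * s) := by
    intro j
    refine (hbound j).trans ?_
    rw [show 88 * s = 11 * s * 8 by ring, pow_mul]
    refine pow_le_pow_left₀ (by positivity) ?_ 8
    rw [hcard2]
    have h1 : ((10 * s + 8 : ℕ) : ℝ) * 2 ^ m ≤ K ^ (2 * s) := by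
      have h2 : (10 * s + 8) * 2 ^ m ≤ 256 ^ (2 * s) := by
        have h3 : 10 * s + 8 ≤ 2 ^ (5 * s) := by
          clear * - hs
          induction s, hs using Nat.le_induction with
          | base => norm_num
          | succ n hn ih =>
            rw [show 5 * (n + 1) = 5 * n + 5 by ring, pow_add]
            omega
        calc (10 * s + 8) * 2 ^ m ≤ 2 ^ (5 * s) * 2 ^ m := by gcongr
          _ = 2 ^ (10 * s + 3) := by rw [← pow_add]; congr 1; omega
          _ ≤ 2 ^ (8 * (2 * s)) := Nat.pow_le_pow_right (by norm_num) (by omega)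
          _ = 256 ^ (2 * s) := by rw [pow_mul]; norm_num
      calc ((10 * s + 8 : ℕ) : ℝ) * 2 ^ m ≤ 256 ^ (2 * s) := by exact_mod_cast h2
        _ ≤ K ^ (2 * s) := by gcongr
    calc ((10 * s + 8 : ℕ) : ℝ) * (2 ^ m * K ^ (m + 1))
        = ((10 * s + 8 : ℕ) : ℝ) * 2 ^ m * K ^ (m + 1) := by ring
      _ ≤ K ^ (2 * s) * K ^ (m + 1) := by gcongr
      _ = K ^ (2 * s + (m + 1)) := (pow_add _ _ _).symm
      _ ≤ K ^ (11 * s) := pow_le_pow_right₀ hK1 (by omega)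
  let P : (Fin (m + 1) → ℤ) → ℤ[X] := fun p => ∑ i : Fin (m + 1), monomial (i : ℕ) (p i)
  have hPcoeff : ∀ p j, (P p).coeff j = if h : j < m + 1 then p ⟨j, h⟩ else 0 := by
    intro p j
    simp only [P, finsetSum_coeff, coeff_monomial]
    split_ifs with h
    · rw [Finset.sum_eq_single ⟨j, h⟩]
      · simp
      · intro i _ hi
        rw [if_neg]
        exact fun hij => hi (Fin.ext hij)
      · simp
    · refine Finset.sum_eq_zero fun i _ => if_neg ?_
      omega
  have hPdeg : ∀ p, (P p).natDegree ≤ m := by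
    intro p
    rw [natDegree_le_iff_coeff_eq_zero]
    intro N hN
    rw [hPcoeff, dif_neg (by omega)]
  have hPbound : ∀ p : Fin (m + 1) → ℤ, (∀ i, |(p i : ℝ)| ≤ K ^ (88 * s)) →
      ∀ j, |((P p).coeff j : ℝ)| ≤ K ^ (88 * s) := by
    intro p hp j
    rw [hPcoeff]
    split_ifs with h
    · exact hp _
    · simp only [Int.cast_zero, abs_zero]
      positivity
  refine ⟨P (t ∘ Sum.inl), P (t ∘ Sum.inr), ?_, hPdeg _, hPdeg _, hPbound _ fun i => hsize _,
    hPbound _ fun i => hsize _, ?_⟩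
  · by_contra! h0
    apply ht0
    funext j
    rcases j with i | i
    · have h := hPcoeff (t ∘ Sum.inl) i
      rw [h0.1, coeff_zero, dif_pos i.2] at h
      exact h.symm
    · have h := hPcoeff (t ∘ Sum.inr) i
      rw [h0.2, coeff_zero, dif_pos i.2] at h
      exact h.symm
  · intro a ha k hk
    have hz : ∀ l : Fin 4, (∑ i : Fin (m + 1), (Nat.choose i k : ℂ) * w (i - k) l * t (Sum.inl i))
        - ∑ i : Fin (m + 1), (Nat.choose i k : ℂ) * w (i - k + 1) l * t (Sum.inr i) = 0 := by
      intro l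
      have h1 := congrFun ht (⟨k, hk⟩, l)
      have h2 := congrArg (Int.cast : ℤ → ℂ) h1
      simpa [T, Matrix.mulVec, dotProduct, Fintype.sum_sum_type, sub_eq_add_neg] using h2
    have hP : ∀ p : Fin (m + 1) → ℤ, (taylor a ((P p).map (Int.castRingHom ℂ))).coeff k
        = ∑ i : Fin (m + 1), (Nat.choose i k : ℂ) * p i * a ^ ((i : ℕ) - k) := by
      intro p
      simp only [P, Polynomial.map_sum, map_monomial, map_sum, taylor_monomial, finsetSum_coeff,
        coeff_C_mul, coeff_X_add_C_pow, eq_intCast]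
      exact Finset.sum_congr rfl fun i _ => by ring
    rw [map_sub, taylor_mul, taylor_C, coeff_sub, coeff_C_mul, hP, hP, Finset.mul_sum]
    have e1 : ∀ i : Fin (m + 1), (Nat.choose i k : ℂ) * (t ∘ Sum.inl) i * a ^ ((i : ℕ) - k)
        = ∑ l : Fin 4, (Nat.choose i k : ℂ) * w (i - k) l * t (Sum.inl i) * a ^ (l : ℕ) := by
      intro i
      rw [pow_eq_sum_powModCoeff ha, Finset.mul_sum]
      exact Finset.sum_congr rfl fun l _ => by simp only [Function.comp]; ring
    have e2 : ∀ i : Fin (m + 1), a * ((Nat.choose i k : ℂ) * (t ∘ Sum.inr) i * a ^ ((i : ℕ) - k))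
        = ∑ l : Fin 4, (Nat.choose i k : ℂ) * w (i - k + 1) l * t (Sum.inr i) * a ^ (l : ℕ) := by
      intro i
      have : a * ((Nat.choose i k : ℂ) * (t ∘ Sum.inr) i * a ^ ((i : ℕ) - k))
        = (Nat.choose i k : ℂ) * (t ∘ Sum.inr) i * a ^ ((i : ℕ) - k + 1) := by ring
      rw [this, pow_eq_sum_powModCoeff ha, Finset.mul_sum]
      exact Finset.sum_congr rfl fun l _ => by simp only [Function.comp]; ring
    simp only [e1, e2]
    rw [Finset.sum_comm, Finset.sum_comm (s := Finset.univ (α := Fin (m + 1))),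
      ← Finset.sum_sub_distrib]
    refine Finset.sum_eq_zero fun l _ => ?_
    rw [← Finset.sum_mul, ← Finset.sum_mul, ← sub_mul, hz, zero_mul]

section Wronskian

open Polynomial

theorem natDegree_eq_of_wronskian_eq_zero {P Q : ℂ[X]} (hP : P ≠ 0) (hQ : Q ≠ 0)
    (h : wronskian P Q = 0) : P.natDegree = Q.natDegree := by
  have hX : ∀ F : ℂ[X], (X * derivative F).coeff F.natDegree = F.natDegree * F.leadingCoeff := by
    intro F
    rcases Nat.eq_zero_or_pos F.natDegree with h0 | h0
    · rw [h0]; simp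
    · obtain ⟨n, hn⟩ := Nat.exists_eq_succ_of_ne_zero h0.ne'
      rw [leadingCoeff, hn, coeff_X_mul, coeff_derivative]
      push_cast; ring
  have hXd : ∀ F : ℂ[X], (X * derivative F).natDegree ≤ F.natDegree := by
    intro F
    rcases Nat.eq_zero_or_pos F.natDegree with h0 | h0
    · rw [derivative_of_natDegree_zero h0]; simp
    · have h1 := natDegree_derivative_le F
      have h2 := natDegree_mul_le (p := X) (q := derivative F)
      rw [natDegree_X] at h2
      omega
  have h1 : P * (X * derivative Q) = (X * derivative P) * Q := by
    rw [wronskian, sub_eq_zero] at h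
    linear_combination X * h
  have h2 := congrArg (fun F => coeff F (P.natDegree + Q.natDegree)) h1
  beta_reduce at h2
  rw [coeff_mul_add_eq_of_natDegree_le le_rfl (hXd Q),
    coeff_mul_add_eq_of_natDegree_le (hXd P) le_rfl, hX, hX] at h2
  have hp : P.leadingCoeff ≠ 0 := leadingCoeff_ne_zero.2 hP
  have hq : Q.leadingCoeff ≠ 0 := leadingCoeff_ne_zero.2 hQ
  have h3 : P.leadingCoeff * Q.leadingCoeff * ((P.natDegree : ℂ) - Q.natDegree) = 0 := by
    simp only [leadingCoeff] at *
    linear_combination -h2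
  have h4 := (mul_eq_zero.1 h3).resolve_left (mul_ne_zero hp hq)
  exact_mod_cast sub_eq_zero.1 h4

theorem exists_common_of_wronskian_eq_zero {P Q : ℂ[X]} (h0 : P ≠ 0 ∨ Q ≠ 0)
    (h : wronskian P Q = 0) : ∃ (F : ℂ[X]) (p q : ℂ), F ≠ 0 ∧ (p ≠ 0 ∨ q ≠ 0) ∧
      F.natDegree ≤ max P.natDegree Q.natDegree ∧ P = C p * F ∧ Q = C q * F := by
  by_cases hQ : Q = 0
  · subst hQ
    exact ⟨P, 1, 0, by simpa using h0, by simp, le_max_left _ _, by simp, by simp⟩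
  · by_cases hP : P = 0
    · subst hP
      exact ⟨Q, 0, 1, by simpa using h0, by simp, le_max_right _ _, by simp, by simp⟩
    refine ⟨Q, P.leadingCoeff / Q.leadingCoeff, 1, hQ, by simp, le_max_right _ _, ?_, by simp⟩
    set c := P.leadingCoeff / Q.leadingCoeff with hc
    have hdeg := natDegree_eq_of_wronskian_eq_zero hP hQ h
    have hq : Q.leadingCoeff ≠ 0 := leadingCoeff_ne_zero.2 hQ
    by_contra hne
    have hR : P - C c * Q ≠ 0 := sub_ne_zero.2 hne
    have hRw : wronskian (P - C c * Q) Q = 0 := by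
      rw [wronskian] at h ⊢
      rw [derivative_sub, derivative_C_mul]
      linear_combination h
    have hRd := natDegree_eq_of_wronskian_eq_zero hR hQ hRw
    apply leadingCoeff_ne_zero.2 hR
    rw [leadingCoeff, hRd, coeff_sub, coeff_C_mul, ← hdeg, coeff_natDegree, hdeg, coeff_natDegree,
      hc, div_mul_cancel₀ _ hq, sub_self]

theorem wronskian_ne_zero_of_pow_dvd {P Q : ℂ[X]} {α : Fin 4 → ℂ} (hα : Function.Injective α)
    {m r : ℕ} (hm : m < 3 * r) (h0 : P ≠ 0 ∨ Q ≠ 0) (hP : P.natDegree ≤ m) (hQ : Q.natDegree ≤ m)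
    (hdvd : ∀ i, (X - C (α i)) ^ r ∣ P - C (α i) * Q) : wronskian P Q ≠ 0 := by
  intro hw
  obtain ⟨F, p, q, hF, hpq, hFd, rfl, rfl⟩ := exists_common_of_wronskian_eq_zero h0 hw
  set S := Finset.univ.filter fun i => p - α i * q ≠ 0 with hS
  have hScard : 3 ≤ S.card := by
    have h1 : (Finset.univ.filter fun i => ¬ (p - α i * q ≠ 0)).card ≤ 1 := by
      refine Finset.card_le_one.2 fun i hi j hj => ?_
      have hi := not_not.1 (Finset.mem_filter.1 hi).2
      have hj := not_not.1 (Finset.mem_filter.1 hj).2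
      by_contra hij
      have h2 : (α i - α j) * q = 0 := by linear_combination hj - hi
      have hq := (mul_eq_zero.1 h2).resolve_left (sub_ne_zero.2 fun h => hij (hα h))
      rw [hq] at hi
      rcases hpq with h | h
      · exact h (by simpa using hi)
      · exact h hq
    have h2 := Finset.card_filter_add_card_filter_not (s := (Finset.univ : Finset (Fin 4)))
      (fun i => p - α i * q ≠ 0)
    rw [Finset.card_univ, Fintype.card_fin, ← hS] at h2
    omega
  have hFi : ∀ i ∈ S, (X - C (α i)) ^ r ∣ F := by
    intro i hi
    have h1 := hdvd i
    have h2 : C p * F - C (α i) * (C q * F) = C (p - α i * q) * F := by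
      rw [C_sub, C_mul]; ring
    rw [h2] at h1
    exact (IsUnit.dvd_mul_left (isUnit_C.2 (isUnit_iff_ne_zero.2 (Finset.mem_filter.1 hi).2))).1 h1
  have hprod : ∏ i ∈ S, (X - C (α i)) ^ r ∣ F := by
    refine Finset.prod_dvd_of_coprime (fun i _ j _ hij => ?_) hFi
    exact (pairwise_coprime_X_sub_C hα hij).pow
  have h1 := natDegree_le_of_dvd hprod hF
  rw [natDegree_prod_of_monic _ _ fun i _ => (monic_X_sub_C _).pow _] at h1
  simp only [natDegree_pow, natDegree_X_sub_C, mul_one, Finset.sum_const, smul_eq_mul] at h1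
  have h2 : F.natDegree ≤ m := by
    rcases hpq with h | h
    · rwa [natDegree_C_mul h] at hP
    · rwa [natDegree_C_mul h] at hQ
  have h3 : 3 * r ≤ S.card * r := Nat.mul_le_mul_right r hScard
  omega

theorem isPrimitive_C_mul_X_sub_C {x y : ℤ} (h : IsCoprime x y) :
    (C y * X - C x : ℤ[X]).IsPrimitive := by
  rw [isPrimitive_iff_isUnit_of_C_dvd]
  intro r hr
  rw [C_dvd_iff_dvd_coeff] at hr
  have h0 : r ∣ x := by simpa using hr 0
  have h1 : r ∣ y := by
    have h2 := hr 1
    rwa [coeff_sub, coeff_C_mul, coeff_X_one, coeff_C_of_ne_zero one_ne_zero, mul_one,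
      sub_zero] at h2
  exact h.isUnit_of_dvd' h0 h1

/-- Gauss's lemma for a root of multiplicity `n` at a rational point. -/
theorem abs_pow_le_abs_leadingCoeff {W : ℤ[X]} (hW : W ≠ 0) {x y : ℤ} (hxy : IsCoprime x y)
    (hy : y ≠ 0) {n : ℕ}
    (h : (X - C ((x : ℚ) / y)) ^ n ∣ W.map (Int.castRingHom ℚ)) :
    |y| ^ n ≤ |W.leadingCoeff| := by
  have hprim : ((C y * X - C x : ℤ[X]) ^ n).IsPrimitive := by
    induction n with
    | zero => simp
    | succ n ih =>
      rw [pow_succ]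
      exact (ih ((pow_dvd_pow _ n.le_succ).trans h)).mul (isPrimitive_C_mul_X_sub_C hxy)
  have hyQ : (y : ℚ) ≠ 0 := by exact_mod_cast hy
  have hdvd : (C y * X - C x : ℤ[X]) ^ n ∣ W := by
    rw [IsPrimitive.Int.dvd_iff_map_cast_dvd_map_cast _ _ hprim]
    have e : ((C y * X - C x : ℤ[X]) ^ n).map (Int.castRingHom ℚ)
        = C ((y : ℚ) ^ n) * (X - C ((x : ℚ) / y)) ^ n := by
      rw [C_pow, ← mul_pow, Polynomial.map_pow]
      congr 1
      rw [mul_sub, ← C_mul, mul_div_cancel₀ _ hyQ]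
      simp
    rw [e]
    exact (IsUnit.mul_left_dvd (isUnit_C.2 (isUnit_iff_ne_zero.2 (pow_ne_zero _ hyQ)))).2 h
  obtain ⟨V, rfl⟩ := hdvd
  have hV : V ≠ 0 := right_ne_zero_of_mul hW
  have hlead : (C y * X - C x : ℤ[X]).leadingCoeff = y := by
    rw [sub_eq_add_neg, ← C_neg]
    exact leadingCoeff_linear hy
  rw [leadingCoeff_mul, leadingCoeff_pow, hlead, abs_mul, abs_pow]
  exact le_mul_of_one_le_right (by positivity)
    (Int.one_le_abs (leadingCoeff_ne_zero.2 hV))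

theorem abs_coeff_mul_le {A B : ℤ[X]} {u v : ℝ} {n : ℕ} (hu : ∀ j, |(A.coeff j : ℝ)| ≤ u)
    (hv : ∀ j, |(B.coeff j : ℝ)| ≤ v) : |((A * B).coeff n : ℝ)| ≤ (n + 1) * (u * v) := by
  have hu0 : 0 ≤ u := (abs_nonneg _).trans (hu 0)
  rw [coeff_mul, Finset.Nat.sum_antidiagonal_eq_sum_range_succ_mk]
  push_cast
  calc |∑ k ∈ Finset.range n.succ, (A.coeff k : ℝ) * (B.coeff (n - k) : ℝ)|
      ≤ ∑ k ∈ Finset.range n.succ, |(A.coeff k : ℝ) * (B.coeff (n - k) : ℝ)| :=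
        Finset.abs_sum_le_sum_abs _ _
    _ ≤ ∑ k ∈ Finset.range n.succ, u * v := by
        refine Finset.sum_le_sum fun k _ => ?_
        rw [abs_mul]
        exact mul_le_mul (hu _) (hv _) (abs_nonneg _) hu0
    _ = (n + 1) * (u * v) := by simp

theorem abs_leadingCoeff_wronskian_le {A B : ℤ[X]} {m : ℕ} (hA : A.natDegree ≤ m)
    (hB : B.natDegree ≤ m) {u : ℝ} (hu : ∀ j, |(A.coeff j : ℝ)| ≤ u)
    (hv : ∀ j, |(B.coeff j : ℝ)| ≤ u) :
    |((wronskian A B).leadingCoeff : ℝ)| ≤ 2 * ((2 * m + 1) * (u * (m * u))) := by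
  have hu0 : 0 ≤ u := (abs_nonneg _).trans (hu 0)
  have hder : ∀ F : ℤ[X], F.natDegree ≤ m → (∀ j, |(F.coeff j : ℝ)| ≤ u) →
      ∀ j, |((derivative F).coeff j : ℝ)| ≤ m * u := by
    intro F hF hFu j
    rw [coeff_derivative]
    push_cast
    rcases lt_or_ge j m with hj | hj
    · rw [abs_mul, mul_comm]
      have h1 : |((j : ℝ) + 1)| ≤ m := by
        rw [abs_of_nonneg (by positivity)]
        exact_mod_cast hj
      exact mul_le_mul h1 (hFu _) (abs_nonneg _) (by positivity)
    · rw [coeff_eq_zero_of_natDegree_lt (by omega)]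
      simp only [Int.cast_zero, zero_mul, abs_zero]
      positivity
  have hn : (wronskian A B).natDegree ≤ 2 * m := by
    by_cases h0 : wronskian A B = 0
    · rw [h0]; simp
    · have := natDegree_wronskian_lt_add h0
      omega
  set n := (wronskian A B).natDegree with hn'
  have hnR : (n : ℝ) ≤ 2 * m := by exact_mod_cast hn
  have h1 := abs_coeff_mul_le (n := n) hu (hder B hB hv)
  have h2 := abs_coeff_mul_le (n := n) (hder A hA hu) hv
  rw [leadingCoeff, ← hn', wronskian, coeff_sub]
  push_cast
  calc _ ≤ |((A * derivative B).coeff n : ℝ)| + |((derivative A * B).coeff n : ℝ)| := abs_sub _ _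
    _ ≤ (n + 1) * (u * (m * u)) + (n + 1) * (m * u * u) := add_le_add h1 h2
    _ = 2 * ((n + 1) * (u * (m * u))) := by ring
    _ ≤ _ := by gcongr

/-- The order of vanishing `j` of `y₁ A - x₁ B` at `x₀ / y₀` is controlled by the Wronskian. -/
theorem exists_taylor_coeff_ne_zero {A B : ℤ[X]} (hW : wronskian A B ≠ 0) {x₀ y₀ x₁ y₁ : ℤ}
    (hxy : IsCoprime x₀ y₀) (hy₀ : y₀ ≠ 0) (hy₁ : y₁ ≠ 0) :
    ∃ j, |y₀| ^ (j - 1) ≤ |(wronskian A B).leadingCoeff| ∧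
      (taylor ((x₀ : ℚ) / y₀)
        ((C y₁ * A - C x₁ * B).map (Int.castRingHom ℚ))).coeff j ≠ 0 := by
  set D : ℤ[X] := C y₁ * A - C x₁ * B with hD
  set q : ℚ := (x₀ : ℚ) / y₀ with hq
  have hWD : C y₁ * wronskian A B = wronskian D B := by
    simp only [wronskian, hD, derivative_sub, derivative_C_mul]
    ring
  have hD0 : D ≠ 0 := by
    intro h
    rw [h, wronskian_zero_left] at hWD
    exact hW ((mul_eq_zero.1 hWD).resolve_left (C_ne_zero.2 hy₁))
  have hDQ : D.map (Int.castRingHom ℚ) ≠ 0 :=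
    (Polynomial.map_ne_zero_iff (RingHom.injective_int _)).2 hD0
  have hT : taylor q (D.map (Int.castRingHom ℚ)) ≠ 0 := fun h => hDQ ((taylor_eq_zero q _).1 h)
  set j := (taylor q (D.map (Int.castRingHom ℚ))).natTrailingDegree with hj
  refine ⟨j, abs_pow_le_abs_leadingCoeff hW hxy hy₀ ?_, trailingCoeff_nonzero_iff_nonzero.2 hT⟩
  have h1 : (X - C q) ^ j ∣ D.map (Int.castRingHom ℚ) := by
    rw [X_sub_C_pow_dvd_iff, ← taylor_apply, X_pow_dvd_iff]
    exact fun d hd => coeff_eq_zero_of_lt_natTrailingDegree hd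
  have h2 : (X - C q) ^ (j - 1) ∣ (wronskian D B).map (Int.castRingHom ℚ) := by
    rw [wronskian, Polynomial.map_sub, Polynomial.map_mul, Polynomial.map_mul,
      ← derivative_map, ← derivative_map]
    exact dvd_sub (((pow_dvd_pow _ (Nat.sub_le j 1)).trans h1).mul_right _)
      ((pow_sub_one_dvd_derivative_of_pow_dvd h1).mul_right _)
  rw [← hWD, Polynomial.map_mul, map_C] at h2
  refine (IsUnit.dvd_mul_left (isUnit_C.2 (isUnit_iff_ne_zero.2 ?_))).1 h2
  simpa using hy₁

end Wronskian

section Taylor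

open Polynomial

theorem hasseDeriv_map_intCast {R : Type*} [CommRing R] (D : ℤ[X]) (j : ℕ) :
    hasseDeriv j (D.map (Int.castRingHom R)) = (hasseDeriv j D).map (Int.castRingHom R) := by
  ext n
  simp [hasseDeriv_coeff]

theorem one_le_pow_mul_norm_taylor_coeff {D : ℤ[X]} {m : ℕ} (hD : D.natDegree ≤ m) {x y : ℤ}
    (hy : y ≠ 0) {j : ℕ}
    (hj : (taylor ((x : ℚ) / y) (D.map (Int.castRingHom ℚ))).coeff j ≠ 0) :
    j ≤ m ∧ 1 ≤ |(y : ℝ)| ^ (m - j) *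
      ‖(taylor ((x : ℂ) / y) (D.map (Int.castRingHom ℂ))).coeff j‖ := by
  have hjm : j ≤ m := by
    by_contra h
    refine hj (coeff_eq_zero_of_natDegree_lt ?_)
    rw [natDegree_taylor]
    exact (natDegree_map_le.trans hD).trans_lt (not_le.1 h)
  refine ⟨hjm, ?_⟩
  set E : ℤ[X] := hasseDeriv j D with hE
  have hEm : E.natDegree ≤ m - j := (natDegree_hasseDeriv_le D j).trans (Nat.sub_le_sub_right hD j)
  rw [taylor_coeff, hasseDeriv_map_intCast] at hj ⊢
  have hcast : eval ((x : ℂ) / y) (E.map (Int.castRingHom ℂ))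
      = ((eval ((x : ℚ) / y) (E.map (Int.castRingHom ℚ)) : ℚ) : ℂ) := by
    have h1 := eval₂_at_apply (p := E.map (Int.castRingHom ℚ)) (algebraMap ℚ ℂ) ((x : ℚ) / y)
    rw [eval₂_map] at h1
    have h2 : (algebraMap ℚ ℂ).comp (Int.castRingHom ℚ) = Int.castRingHom ℂ := RingHom.ext_int _ _
    rw [h2, map_div₀, map_intCast, map_intCast, eq_ratCast] at h1
    rw [eval_map, h1]
  have key : (1 : ℚ) ≤ |(y : ℚ)| ^ E.natDegree
      * |eval ((x : ℚ) / y) (E.map (Int.castRingHom ℚ))| := by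
    rcases lt_or_gt_of_ne hy with h | h
    · have h1 := one_le_pow_mul_abs_eval_div (K := ℚ) (f := E) (a := -x) (b := -y) (by omega)
      push_cast at h1
      rw [neg_div_neg_eq] at h1
      rw [abs_of_neg (by exact_mod_cast h)]
      exact h1 hj
    · rw [abs_of_pos (by exact_mod_cast h)]
      exact one_le_pow_mul_abs_eval_div h hj
  rw [hcast, Complex.norm_ratCast]
  have key' : (1 : ℝ) ≤ |(y : ℝ)| ^ E.natDegree
      * |((eval ((x : ℚ) / y) (E.map (Int.castRingHom ℚ)) : ℚ) : ℝ)| := by exact_mod_cast key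
  refine key'.trans ?_
  have hy1 : 1 ≤ |(y : ℝ)| := by exact_mod_cast Int.one_le_abs hy
  gcongr

theorem norm_taylor_coeff_le {P : ℂ[X]} {m r j : ℕ} {u w : ℝ} {t : ℂ} (hP : P.natDegree ≤ m)
    (hu : ∀ k, ‖P.coeff k‖ ≤ u) (hr : ∀ k < r, P.coeff k = 0) (hw : 0 ≤ w)
    (ht : ∀ n, r - j ≤ n → n ≤ m → ‖t‖ ^ n ≤ w) :
    ‖(taylor t P).coeff j‖ ≤ (m + 1) * 2 ^ m * u * w := by
  have hu0 : 0 ≤ u := (norm_nonneg _).trans (hu 0)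
  have hd : (hasseDeriv j P).natDegree < m + 1 :=
    Nat.lt_succ_of_le ((natDegree_hasseDeriv_le P j).trans ((Nat.sub_le _ _).trans hP))
  rw [taylor_coeff, eval_eq_sum_range' hd]
  calc _ ≤ ∑ n ∈ Finset.range (m + 1), ‖(hasseDeriv j P).coeff n * t ^ n‖ := norm_sum_le _ _
    _ ≤ ∑ n ∈ Finset.range (m + 1), 2 ^ m * u * w := by
        refine Finset.sum_le_sum fun n hn => ?_
        have hn := Finset.mem_range.1 hn
        rw [hasseDeriv_coeff]
        by_cases h1 : n + j < r
        · rw [hr _ h1]; simp; positivity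
        by_cases h2 : m < n + j
        · rw [coeff_eq_zero_of_natDegree_lt (hP.trans_lt h2)]; simp; positivity
        have h3 : ((n + j).choose j : ℝ) ≤ 2 ^ m := by
          exact_mod_cast (Nat.choose_le_two_pow _ _).trans
            (Nat.pow_le_pow_right two_pos (by omega))
        rw [norm_mul, norm_mul, norm_pow, Complex.norm_natCast]
        gcongr
        · exact hu _
        · exact ht n (by omega) (by omega)
    _ = _ := by simp; ring

theorem norm_taylor_combination_le {A B : ℤ[X]} {m r j : ℕ} {u L δ : ℝ} {a q : ℂ} {x y : ℤ}
    (hA : A.natDegree ≤ m) (hB : B.natDegree ≤ m) (hu : ∀ k, |(A.coeff k : ℝ)| ≤ u)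
    (hv : ∀ k, |(B.coeff k : ℝ)| ≤ u)
    (hvan : ∀ k < r,
      (taylor a (A.map (Int.castRingHom ℂ) - C a * B.map (Int.castRingHom ℂ))).coeff k = 0)
    (ha : ‖a‖ + 1 ≤ L) (hδ : ‖q - a‖ ≤ δ) (hδ1 : δ ≤ 1) (hy : y ≠ 0) :
    ‖(taylor q ((C y * A - C x * B).map (Int.castRingHom ℂ))).coeff j‖
      ≤ |(y : ℝ)| * (((m + 1) * 2 ^ m) ^ 2 * u * L ^ (m + 1) *
        (δ ^ (r - j) + ‖a - (x : ℂ) / y‖)) := by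
  set A' := A.map (Int.castRingHom ℂ) with hA'
  set B' := B.map (Int.castRingHom ℂ) with hB'
  set P := A' - C a * B' with hP
  have hu0 : 0 ≤ u := (abs_nonneg _).trans (hu 0)
  have hL1 : 1 ≤ L := by linarith [norm_nonneg a]
  have hL0 : 0 ≤ L := by linarith
  have hδ0 : 0 ≤ δ := (norm_nonneg _).trans hδ
  have hyC : (y : ℂ) ≠ 0 := by exact_mod_cast hy
  have hA'd : A'.natDegree ≤ m := natDegree_map_le.trans hA
  have hB'd : B'.natDegree ≤ m := natDegree_map_le.trans hB
  have hPd : P.natDegree ≤ m :=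
    (natDegree_sub_le _ _).trans (max_le hA'd ((natDegree_C_mul_le _ _).trans hB'd))
  have hA'u : ∀ k, ‖A'.coeff k‖ ≤ u := fun k => by
    rw [hA', coeff_map, eq_intCast, Complex.norm_intCast]; exact hu k
  have hB'u : ∀ k, ‖B'.coeff k‖ ≤ u := fun k => by
    rw [hB', coeff_map, eq_intCast, Complex.norm_intCast]; exact hv k
  have hPu : ∀ k, ‖P.coeff k‖ ≤ L * u := fun k => by
    rw [hP, coeff_sub, coeff_C_mul]
    calc _ ≤ ‖A'.coeff k‖ + ‖a * B'.coeff k‖ := norm_sub_le _ _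
      _ ≤ u + ‖a‖ * u := by
          rw [norm_mul]
          exact add_le_add (hA'u k) (mul_le_mul_of_nonneg_left (hB'u k) (norm_nonneg _))
      _ = (‖a‖ + 1) * u := by ring
      _ ≤ L * u := by gcongr
  have hq : ‖q‖ ≤ L := by
    calc ‖q‖ = ‖a + (q - a)‖ := by ring_nf
      _ ≤ ‖a‖ + ‖q - a‖ := norm_add_le _ _
      _ ≤ L := by linarith
  have hpow : ∀ t : ℂ, ‖t‖ ≤ L → ∀ n, n ≤ m → ‖t‖ ^ n ≤ L ^ m := fun t ht n hn =>
    (pow_le_pow_left₀ (norm_nonneg _) ht n).trans (pow_le_pow_right₀ hL1 hn)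
  have h1 : ∀ k, ‖(taylor a P).coeff k‖ ≤ (m + 1) * 2 ^ m * (L * u) * L ^ m := fun k =>
    norm_taylor_coeff_le (r := 0) hPd hPu (fun k hk => absurd hk k.not_lt_zero) (by positivity)
      fun n _ hn => hpow a (by linarith) n hn
  have h2 : ‖(taylor q B').coeff j‖ ≤ (m + 1) * 2 ^ m * u * L ^ m :=
    norm_taylor_coeff_le (r := 0) hB'd hB'u (fun k hk => absurd hk k.not_lt_zero) (by positivity)
      fun n _ hn => hpow q hq n hn
  have h3 : ‖(taylor q P).coeff j‖
      ≤ (m + 1) * 2 ^ m * ((m + 1) * 2 ^ m * (L * u) * L ^ m) * δ ^ (r - j) := by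
    have e : taylor q P = taylor (q - a) (taylor a P) := by rw [taylor_taylor, sub_add_cancel]
    rw [e]
    refine norm_taylor_coeff_le (by rwa [natDegree_taylor]) h1 hvan (by positivity) fun n hn _ => ?_
    exact (pow_le_pow_left₀ (norm_nonneg _) hδ n).trans (pow_le_pow_of_le_one hδ0 hδ1 hn)
  have e : (taylor q ((C y * A - C x * B).map (Int.castRingHom ℂ))).coeff j
      = y * ((taylor q P).coeff j + (a - (x : ℂ) / y) * (taylor q B').coeff j) := by
    have e1 : (C y * A - C x * B).map (Int.castRingHom ℂ)
        = C (y : ℂ) * (P + C (a - (x : ℂ) / y) * B') := by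
      rw [Polynomial.map_sub, Polynomial.map_mul, Polynomial.map_mul, map_C, map_C, eq_intCast,
        eq_intCast, ← hA', ← hB', hP, C_sub, mul_add, ← mul_assoc (C (y : ℂ)), mul_sub (C (y : ℂ)),
        mul_sub (C (y : ℂ)), ← C_mul (b := (x : ℂ) / y), mul_div_cancel₀ _ hyC]
      ring
    rw [e1]
    simp only [taylor_mul, taylor_C, map_add, coeff_C_mul, coeff_add]
  rw [e, norm_mul, Complex.norm_intCast]
  gcongr
  have h4 : (1 : ℝ) ≤ (m + 1) * 2 ^ m :=
    one_le_mul_of_one_le_of_one_le (by linarith [(Nat.cast_nonneg m : (0 : ℝ) ≤ m)])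
      (one_le_pow₀ one_le_two)
  set g : ℝ := (m + 1) * 2 ^ m with hg
  have h5 : g * u * L ^ m ≤ g ^ 2 * u * L ^ (m + 1) := by
    rw [pow_succ L, ← mul_assoc]
    calc g * u * L ^ m ≤ g * (g * u * L ^ m) := le_mul_of_one_le_left (by positivity) h4
      _ = g ^ 2 * u * L ^ m := by ring
      _ ≤ _ := le_mul_of_one_le_right (by positivity) hL1
  calc _ ≤ ‖(taylor q P).coeff j‖ + ‖(a - (x : ℂ) / y) * (taylor q B').coeff j‖ :=
        norm_add_le _ _
    _ ≤ g * (g * (L * u) * L ^ m) * δ ^ (r - j)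
        + ‖a - (x : ℂ) / y‖ * (g ^ 2 * u * L ^ (m + 1)) := by
        rw [norm_mul]
        exact add_le_add h3 (mul_le_mul_of_nonneg_left (h2.trans h5) (norm_nonneg _))
    _ = _ := by ring

end Taylor

section Contradiction

open Polynomial

theorem exists_pow_lt_le {Q R : ℝ} (hQ : 1 < Q) (h : Q ^ 27 < R ^ 10) :
    ∃ s : ℕ, 1 ≤ s ∧ Q ^ (17 * s + 10) < R ^ 10 ∧ R ^ 10 ≤ Q ^ (17 * s + 27) := by
  classical
  have hex : ∃ n : ℕ, R ^ 10 ≤ Q ^ (17 * n + 27) := by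
    obtain ⟨n, hn⟩ := pow_unbounded_of_one_lt (R ^ 10) hQ
    exact ⟨n, hn.le.trans (pow_le_pow_right₀ hQ.le (by omega))⟩
  have h1 := Nat.find_spec hex
  have h2 : Nat.find hex ≠ 0 := by
    intro h0
    rw [h0] at h1
    exact absurd h1 (not_le.2 h)
  obtain ⟨n, hn⟩ := Nat.exists_eq_succ_of_ne_zero h2
  refine ⟨Nat.find hex, Nat.one_le_iff_ne_zero.2 h2, ?_, h1⟩
  have h3 := Nat.find_min hex (m := n) (by omega)
  rw [hn]
  exact not_le.1 h3

theorem sq_mul_pow_le_pow {K : ℝ} (hK : 256 ≤ K) {s : ℕ} (hs : 1 ≤ s) :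
    ((((5 * s + 3 : ℕ) : ℝ) + 1) * 2 ^ (5 * s + 3)) ^ 2 * K ^ (88 * s) * K ^ (5 * s + 3 + 1)
      ≤ K ^ (110 * s) := by
  have hK1 : 1 ≤ K := by linarith
  have h1 : 5 * s + 4 ≤ 16 ^ s := by
    induction s, hs using Nat.le_induction with
    | base => norm_num
    | succ n hn ih => rw [pow_succ]; omega
  have h2 : (((5 * s + 3 : ℕ) : ℝ) + 1) ≤ 16 ^ s := by
    have : ((5 * s + 4 : ℕ) : ℝ) ≤ 16 ^ s := by exact_mod_cast h1
    push_cast at this ⊢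
    linarith
  have h3 : (2 : ℝ) ^ (5 * s + 3) ≤ 256 ^ s := by
    rw [show (256 : ℝ) = 2 ^ 8 by norm_num, ← pow_mul]
    exact pow_le_pow_right₀ one_le_two (by omega)
  calc _ ≤ ((16 : ℝ) ^ s * 256 ^ s) ^ 2 * K ^ (88 * s) * K ^ (9 * s) := by
        gcongr
        omega
    _ = (256 : ℝ) ^ (3 * s) * K ^ (88 * s) * K ^ (9 * s) := by
        congr 2
        rw [show (256 : ℝ) = 16 ^ 2 by norm_num]
        simp only [← pow_mul, ← pow_add]
        congr 1
        ring
    _ ≤ K ^ (3 * s) * K ^ (88 * s) * K ^ (9 * s) := by gcongr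
    _ = K ^ (100 * s) := by rw [← pow_add, ← pow_add]; congr 1; ring
    _ ≤ _ := pow_le_pow_right₀ hK1 (by omega)

theorem two_mul_pow_lt_of_far {K Q R : ℝ} (hK : 256 ≤ K) (hQ : K ^ 1800 ≤ Q)
    {s j : ℕ} (hs : 1 ≤ s) (hj : 10 * (j - 1) ≤ s) (hu : R ^ 10 ≤ Q ^ (17 * s + 27)) :
    2 * Q ^ (5 * s + 3 - j) * R * (K ^ (110 * s) * (K ^ 2) ^ (2 * s + 2 - j))
      < (Q ^ 4) ^ (2 * s + 2 - j) := by
  have hK0 : 0 ≤ K := by linarith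
  have hK1 : 1 < K := by linarith
  have hQ1 : 1 ≤ Q := (one_le_pow₀ hK1.le).trans hQ
  have hQ0 : 0 ≤ Q := by linarith
  refine lt_of_pow_lt_pow_left₀ 10 (by positivity) ?_
  calc (2 * Q ^ (5 * s + 3 - j) * R * (K ^ (110 * s) * (K ^ 2) ^ (2 * s + 2 - j))) ^ 10
      = R ^ 10 * (Q ^ (10 * (5 * s + 3 - j)) *
        (2 ^ 10 * K ^ (1100 * s + 20 * (2 * s + 2 - j)))) := by
        simp only [mul_pow, ← pow_mul, pow_add, ← mul_assoc]
        ring_nf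
    _ ≤ Q ^ (17 * s + 27) * (Q ^ (10 * (5 * s + 3 - j)) * (K ^ 2 * K ^ (1180 * s))) := by
        gcongr
        · nlinarith
        · exact hK1.le
        · omega
    _ < Q ^ (17 * s + 27) * (Q ^ (10 * (5 * s + 3 - j)) * Q ^ s) := by
        gcongr
        calc K ^ 2 * K ^ (1180 * s) = K ^ (1180 * s + 2) := by ring
          _ < K ^ (1800 * s) := pow_lt_pow_right₀ hK1 (by omega)
          _ = (K ^ 1800) ^ s := pow_mul _ _ _
          _ ≤ Q ^ s := by gcongr
    _ = Q ^ (17 * s + 27 + (10 * (5 * s + 3 - j) + s)) := by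
        rw [pow_add Q (17 * s + 27), pow_add Q (10 * _)]
    _ ≤ Q ^ (4 * (2 * s + 2 - j) * 10) := pow_le_pow_right₀ hQ1 (by omega)
    _ = _ := by rw [pow_mul, pow_mul]

theorem two_mul_pow_lt_of_near {K Q R : ℝ} (hK : 256 ≤ K) (hQ : K ^ 1800 ≤ Q) (hR : 0 ≤ R)
    {s j : ℕ} (hs : 1 ≤ s) (hl : Q ^ (17 * s + 10) < R ^ 10) :
    2 * Q ^ (5 * s + 3 - j) * (K ^ (110 * s) * K ^ 2) < R ^ 3 := by
  have hK0 : 0 ≤ K := by linarith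
  have hK1 : 1 < K := by linarith
  have hQ1 : 1 ≤ Q := (one_le_pow₀ hK1.le).trans hQ
  have hQ0 : 0 ≤ Q := by linarith
  refine lt_of_pow_lt_pow_left₀ 10 (by positivity) ?_
  calc (2 * Q ^ (5 * s + 3 - j) * (K ^ (110 * s) * K ^ 2)) ^ 10
      = Q ^ (10 * (5 * s + 3 - j)) * (2 ^ 10 * K ^ (1100 * s + 20)) := by
        simp only [mul_pow, ← pow_mul, pow_add, ← mul_assoc]
        ring_nf
    _ ≤ Q ^ (10 * (5 * s + 3)) * (K ^ 2 * K ^ (1120 * s)) := by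
        gcongr
        · omega
        · nlinarith
        · exact hK1.le
        · omega
    _ ≤ Q ^ (10 * (5 * s + 3)) * Q ^ s := by
        gcongr
        calc K ^ 2 * K ^ (1120 * s) = K ^ (1120 * s + 2) := by ring
          _ ≤ K ^ (1800 * s) := pow_le_pow_right₀ hK1.le (by omega)
          _ = (K ^ 1800) ^ s := pow_mul _ _ _
          _ ≤ Q ^ s := by gcongr
    _ = Q ^ (10 * (5 * s + 3) + s) := by rw [pow_add]
    _ ≤ Q ^ ((17 * s + 10) * 3) := pow_le_pow_right₀ hQ1 (by omega)
    _ = (Q ^ (17 * s + 10)) ^ 3 := pow_mul _ _ _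
    _ < (R ^ 10) ^ 3 := by gcongr
    _ = (R ^ 3) ^ 10 := by ring

theorem ten_mul_pred_le {K Q : ℝ} (hK : 256 ≤ K) (hQ : K ^ 1800 ≤ Q) {s j : ℕ} (hs : 1 ≤ s)
    (h : Q ^ (j - 1) ≤ 2 * ((2 * ((5 * s + 3 : ℕ) : ℝ) + 1) * (K ^ (88 * s) *
      (((5 * s + 3 : ℕ) : ℝ) * K ^ (88 * s))))) : 10 * (j - 1) ≤ s := by
  have hK0 : 0 ≤ K := by linarith
  have hK1 : 1 < K := by linarith
  have h1 : 2 * (2 * (5 * s + 3) + 1) * (5 * s + 3) ≤ 272 ^ s := by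
    have h2 : 2 * (2 * (5 * s + 3) + 1) * (5 * s + 3) ≤ 272 * (s * s) := by nlinarith
    have h3 : s ≤ 2 ^ (s - 1) := by
      have := Nat.lt_two_pow_self (n := s - 1)
      omega
    obtain ⟨n, rfl⟩ : ∃ n, s = n + 1 := ⟨s - 1, by omega⟩
    rw [Nat.add_sub_cancel] at h3
    calc _ ≤ 272 * ((n + 1) * (n + 1)) := h2
      _ ≤ 272 * (2 ^ n * 2 ^ n) := by gcongr
      _ = 272 * 4 ^ n := by rw [← mul_pow]; norm_num
      _ ≤ 272 * 272 ^ n := by gcongr; norm_num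
      _ = 272 ^ (n + 1) := by rw [pow_succ, mul_comm]
  have h2 : 2 * (2 * ((5 * s + 3 : ℕ) : ℝ) + 1) * ((5 * s + 3 : ℕ) : ℝ) ≤ 272 ^ s := by
    exact_mod_cast h1
  have h3 : K ^ (1800 * (j - 1)) ≤ K ^ (178 * s) := by
    calc K ^ (1800 * (j - 1)) = (K ^ 1800) ^ (j - 1) := pow_mul _ _ _
      _ ≤ Q ^ (j - 1) := by gcongr
      _ ≤ 2 * (2 * ((5 * s + 3 : ℕ) : ℝ) + 1) * ((5 * s + 3 : ℕ) : ℝ) *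
          (K ^ (88 * s) * K ^ (88 * s)) := by linarith
      _ ≤ 272 ^ s * (K ^ (88 * s) * K ^ (88 * s)) := by gcongr
      _ ≤ (K ^ 2) ^ s * (K ^ (88 * s) * K ^ (88 * s)) := by gcongr; nlinarith
      _ = _ := by rw [← pow_mul, ← pow_add, ← pow_add]; congr 1; ring
  have h4 := (pow_le_pow_iff_right₀ hK1).1 h3
  omega

/-- There are no two exceptionally good approximations to a root of a monic quartic, one much
better than the other. -/
theorem not_two_large_approximations {α : Fin 4 → ℂ} {b c d e : ℤ} {K : ℝ}
    (hα : Function.Injective α) (hroot : ∀ i, α i ^ 4 + b * α i ^ 3 + c * α i ^ 2 + d * α i + e = 0)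
    (hK : 256 ≤ K) (hb : 1 + |(b : ℝ)| ≤ K) (hc : 1 + |(c : ℝ)| ≤ K) (hd : 1 + |(d : ℝ)| ≤ K)
    (he : 1 + |(e : ℝ)| ≤ K) {i : Fin 4} (hi : ‖α i‖ + 1 ≤ K) {x₀ y₀ x₁ y₁ : ℤ}
    (hxy : IsCoprime x₀ y₀) (hQ : K ^ 1800 ≤ |(y₀ : ℝ)|)
    (hR : |(y₀ : ℝ)| ^ 3 ≤ K ^ 2 * |(y₁ : ℝ)|)
    (h₀ : ‖(x₀ : ℂ) - α i * y₀‖ * |(y₀ : ℝ)| ^ 3 ≤ K ^ 2)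
    (h₁ : ‖(x₁ : ℂ) - α i * y₁‖ * |(y₁ : ℝ)| ^ 3 ≤ K ^ 2) : False := by
  set Q := |(y₀ : ℝ)| with hQdef
  set R := |(y₁ : ℝ)| with hRdef
  have hK0 : 0 ≤ K := by linarith
  have hK1 : 1 < K := by linarith
  have hQK : K ^ 20 < Q := (pow_lt_pow_right₀ hK1 (by norm_num)).trans_le hQ
  have hQ1 : 1 < Q := (one_lt_pow₀ hK1 (by norm_num)).trans hQK
  have hQ0 : 0 < Q := by linarith
  have hR0 : 0 < R := by
    have h1 : 0 < K ^ 2 * R := (pow_pos hQ0 3).trans_le hR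
    exact pos_of_mul_pos_right h1 (by positivity)
  have hy₀ : y₀ ≠ 0 := by rintro rfl; simp [hQdef] at hQ0
  have hy₁ : y₁ ≠ 0 := by rintro rfl; simp [hRdef] at hR0
  have happrox : ∀ x y : ℤ, 0 < |(y : ℝ)| → ‖(x : ℂ) - α i * y‖ * |(y : ℝ)| ^ 3 ≤ K ^ 2 →
      ‖(x : ℂ) / y - α i‖ ≤ K ^ 2 / |(y : ℝ)| ^ 4 := by
    intro x y hy h
    have hyC : (y : ℂ) ≠ 0 := by
      rintro h0
      have : y = 0 := by exact_mod_cast h0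
      simp [this] at hy
    rw [div_sub' hyC, norm_div, Complex.norm_intCast, div_le_div_iff₀ hy (by positivity),
      mul_comm (y : ℂ)]
    calc _ = ‖(x : ℂ) - α i * y‖ * |(y : ℝ)| ^ 3 * |(y : ℝ)| := by ring
      _ ≤ _ := by gcongr
  have hδ := happrox x₀ y₀ hQ0 h₀
  have hε := happrox x₁ y₁ hR0 h₁
  rw [norm_sub_rev] at hε
  have hδ1 : K ^ 2 / Q ^ 4 ≤ 1 := by
    rw [div_le_one (by positivity)]
    calc K ^ 2 ≤ K ^ 20 := pow_le_pow_right₀ hK1.le (by norm_num)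
      _ ≤ Q := hQK.le
      _ ≤ Q ^ 4 := le_self_pow₀ hQ1.le (by norm_num)
  have hQR : Q ^ 27 < R ^ 10 := by
    have h1 : Q ^ 30 ≤ K ^ 20 * R ^ 10 := by
      calc Q ^ 30 = (Q ^ 3) ^ 10 := by ring
        _ ≤ (K ^ 2 * R) ^ 10 := by gcongr
        _ = _ := by ring
    have h2 : Q * Q ^ 29 < Q * R ^ 10 := by
      calc Q * Q ^ 29 = Q ^ 30 := by ring
        _ ≤ K ^ 20 * R ^ 10 := h1
        _ < _ := by gcongr
    exact (pow_le_pow_right₀ hQ1.le (by norm_num)).trans_lt (lt_of_mul_lt_mul_left h2 hQ0.le)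
  obtain ⟨s, hs, hl, hu⟩ := exists_pow_lt_le hQ1 hQR
  obtain ⟨A, B, hAB, hA, hB, hAu, hBu, hvan⟩ := exists_auxiliary_polynomials hK hb hc hd he hs
  have hinj := RingHom.injective_int (Int.castRingHom ℂ)
  have hW : wronskian A B ≠ 0 := by
    have h1 : wronskian (A.map (Int.castRingHom ℂ)) (B.map (Int.castRingHom ℂ)) ≠ 0 := by
      refine wronskian_ne_zero_of_pow_dvd hα (m := 5 * s + 3) (r := 2 * s + 2) (by omega) ?_
        (natDegree_map_le.trans hA) (natDegree_map_le.trans hB) fun k => ?_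
      · exact hAB.imp (Polynomial.map_ne_zero_iff hinj).2 (Polynomial.map_ne_zero_iff hinj).2
      · rw [X_sub_C_pow_dvd_iff, ← taylor_apply, X_pow_dvd_iff]
        exact hvan (α k) (hroot k)
    intro h
    apply h1
    have h2 := congrArg (Polynomial.map (Int.castRingHom ℂ)) h
    rw [wronskian, Polynomial.map_sub, Polynomial.map_mul, Polynomial.map_mul, ← derivative_map,
      ← derivative_map, Polynomial.map_zero] at h2
    exact h2
  obtain ⟨j, hj, hne⟩ := exists_taylor_coeff_ne_zero hW hxy hy₀ hy₁ (x₁ := x₁)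
  have hj' : Q ^ (j - 1) ≤ |((wronskian A B).leadingCoeff : ℝ)| := by
    rw [hQdef]
    exact_mod_cast hj
  have hj10 := ten_mul_pred_le hK hQ hs
    (hj'.trans (abs_leadingCoeff_wronskian_le hA hB hAu hBu))
  have hDdeg : (C y₁ * A - C x₁ * B).natDegree ≤ 5 * s + 3 :=
    (natDegree_sub_le _ _).trans
      (max_le ((natDegree_C_mul_le _ _).trans hA) ((natDegree_C_mul_le _ _).trans hB))
  obtain ⟨-, hint⟩ := one_le_pow_mul_norm_taylor_coeff hDdeg hy₀ hne
  have hup := norm_taylor_combination_le (j := j) hA hB hAu hBu (hvan (α i) (hroot i)) hi hδ hδ1 hy₁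
    (x := x₁)
  rw [← hQdef] at hint
  rw [← hRdef] at hup
  set G := ((((5 * s + 3 : ℕ) : ℝ) + 1) * 2 ^ (5 * s + 3)) ^ 2 * K ^ (88 * s) * K ^ (5 * s + 3 + 1)
    with hG
  have hGle : G ≤ K ^ (110 * s) := sq_mul_pow_le_pow hK hs
  set N := Q ^ (5 * s + 3 - j) with hN
  have hN0 : 0 < N := pow_pos hQ0 _
  have hfar := two_mul_pow_lt_of_far hK hQ hs hj10 hu
  have hnear := two_mul_pow_lt_of_near (j := j) hK hQ hR0.le hs hl
  rw [← hN] at hfar hnear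
  have h5 : N * R * (K ^ (110 * s) * (K ^ 2 / Q ^ 4) ^ (2 * s + 2 - j)) < 1 / 2 := by
    rw [div_pow, ← mul_div_assoc, ← mul_div_assoc, div_lt_iff₀ (by positivity)]
    linarith
  have h6 : N * R * (K ^ (110 * s) * (K ^ 2 / R ^ 4)) < 1 / 2 := by
    rw [← mul_div_assoc, ← mul_div_assoc, div_lt_iff₀ (by positivity)]
    have := mul_lt_mul_of_pos_left hnear hR0
    linarith
  have h7 : (1 : ℝ) ≤ N * (R * (K ^ (110 * s) *
      ((K ^ 2 / Q ^ 4) ^ (2 * s + 2 - j) + K ^ 2 / R ^ 4))) := by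
    refine hint.trans (mul_le_mul_of_nonneg_left (hup.trans ?_) hN0.le)
    gcongr
  linarith

theorem not_isAdmissible (α₀ : Fin 4 → ℂ) : ¬ IsAdmissible 47 α₀ := by
  intro h
  obtain ⟨α, ⟨⟨b, c, d, e, hf⟩, hD, -⟩, i, x₀, y₀, x₁, y₁, -, hxy, hQ, hR, h₀, h₁⟩ :=
    h.exists_large_pair
  have hinj : Function.Injective α := by
    rw [← Matrix.det_vandermonde_ne_zero_iff, ← norm_pos_iff]
    linarith
  have hM := four_le_scaledHeight_pow hD
  have hM1 := one_le_scaledHeight α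
  set M := scaledHeight α with hMdef
  have hM2 : 3 / 2 ≤ M := by
    by_contra! hlt
    have : M ^ 3 < (3 / 2) ^ 3 := by gcongr
    norm_num at this
    linarith
  obtain ⟨t, ht⟩ : ∃ t : Fin 4 → ℝ, t = fun k => max 1 (2 / 5 * ‖α k‖) := ⟨_, rfl⟩
  have ht1 : ∀ k, 1 ≤ t k := fun k => by rw [ht]; exact le_max_left _ _
  have htα : ∀ k, ‖α k‖ ≤ 5 / 2 * t k := fun k => by
    have : 2 / 5 * ‖α k‖ ≤ t k := by rw [ht]; exact le_max_right _ _
    linarith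
  have hprod : ∀ S : Finset (Fin 4), ‖∏ k ∈ S, α k‖ ≤ 625 / 16 * M := by
    intro S
    calc ‖∏ k ∈ S, α k‖ = ∏ k, if k ∈ S then ‖α k‖ else 1 := by
          rw [norm_prod, Finset.prod_ite_mem, Finset.univ_inter]
      _ ≤ ∏ k, 5 / 2 * t k := by
          refine Finset.prod_le_prod (fun k _ => by positivity) fun k _ => ?_
          split_ifs
          · exact htα k
          · linarith [ht1 k]
      _ = 625 / 16 * ∏ k, t k := by
          rw [Finset.prod_mul_distrib, Finset.prod_const]
          norm_num
      _ = _ := by rw [hMdef, scaledHeight, ht]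
  have h1 : ∀ k, ‖α k‖ ≤ 625 / 16 * M := fun k => by simpa using hprod {k}
  have h2 : ∀ k l, k ≠ l → ‖α k * α l‖ ≤ 625 / 16 * M := fun k l hkl => by
    simpa only [Finset.prod_pair hkl] using hprod {k, l}
  have h3 : ∀ k l n, k ≠ l → k ≠ n → l ≠ n → ‖α k * α l * α n‖ ≤ 625 / 16 * M :=
    fun k l n hkl hkn hln => by
      have h := hprod {k, l, n}
      rwa [Finset.prod_insert (by simp [hkl, hkn]), Finset.prod_pair hln, ← mul_assoc] at h
  have h4 : ‖α 0 * α 1 * α 2 * α 3‖ ≤ 625 / 16 * M := by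
    simpa only [Fin.prod_univ_four] using hprod Finset.univ
  obtain ⟨hb, hc, hd, he⟩ := coeff_eq_of_prod_eq α b c d e hf
  have hb' : |(b : ℝ)| ≤ 239 * M := by
    rw [← Complex.norm_intCast, hb, norm_neg]
    refine norm_add₄_le.trans ?_
    linarith [h1 0, h1 1, h1 2, h1 3]
  have hc' : |(c : ℝ)| ≤ 239 * M := by
    rw [← Complex.norm_intCast, hc]
    refine (norm_add_le _ _).trans ((add_le_add_left ((norm_add_le _ _).trans
      (add_le_add_left norm_add₄_le _)) _).trans ?_)
    linarith [h2 0 1 (by decide), h2 0 2 (by decide), h2 0 3 (by decide), h2 1 2 (by decide),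
      h2 1 3 (by decide), h2 2 3 (by decide)]
  have hd' : |(d : ℝ)| ≤ 239 * M := by
    rw [← Complex.norm_intCast, hd, norm_neg]
    refine norm_add₄_le.trans ?_
    linarith [h3 0 1 2 (by decide) (by decide) (by decide),
      h3 0 1 3 (by decide) (by decide) (by decide), h3 0 2 3 (by decide) (by decide) (by decide),
      h3 1 2 3 (by decide) (by decide) (by decide)]
  have he' : |(e : ℝ)| ≤ 239 * M := by
    rw [← Complex.norm_intCast, he]
    linarith
  have hroot : ∀ i, α i ^ 4 + b * α i ^ 3 + c * α i ^ 2 + d * α i + e = 0 := fun i => by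
    have h := hf (α i) 1
    rw [Finset.prod_eq_zero (Finset.mem_univ i) (by ring)] at h
    linear_combination -h
  exact not_two_large_approximations hinj hroot (K := 240 * M) (by linarith) (by linarith)
    (by linarith) (by linarith) (by linarith) (by linarith [h1 i]) hxy hQ hR h₀ h₁

end Contradiction

section Reduction

/-- A finite set of pairwise linearly independent solutions of the Thue equation. -/
def IsSolutionSet (a b c d e : ℤ) (Z : Finset (ℤ × ℤ)) : Prop :=
  (∀ z ∈ Z, |quarticEval a b c d e z.1 z.2| = 1) ∧
    ∀ z ∈ Z, ∀ w ∈ Z, z ≠ w → z.1 * w.2 - w.1 * z.2 ≠ 0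

/-- The linear map `(X, Y) ↦ (x X + u Y, y X + v Y)`. -/
def linearSubst (x u y v : ℤ) (z : ℤ × ℤ) : ℤ × ℤ := (x * z.1 + u * z.2, y * z.1 + v * z.2)

theorem linearSubst_injective {x u y v : ℤ} (h : x * v - u * y ≠ 0) :
    Function.Injective (linearSubst x u y v) := by
  rintro ⟨X, Y⟩ ⟨X', Y'⟩ hz
  simp only [linearSubst, Prod.mk.injEq] at hz
  obtain ⟨h1, h2⟩ := hz
  have h3 : (x * v - u * y) * (X - X') = 0 := by linear_combination v * h1 - u * h2
  have h4 : (x * v - u * y) * (Y - Y') = 0 := by linear_combination x * h2 - y * h1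
  have h5 := (mul_eq_zero.1 h3).resolve_left h
  have h6 := (mul_eq_zero.1 h4).resolve_left h
  rw [Prod.mk.injEq]
  exact ⟨by linarith, by linarith⟩

theorem IsSolutionSet.exists_subst {a b c d e : ℤ} {Z : Finset (ℤ × ℤ)}
    (hZ : IsSolutionSet a b c d e Z) {x u y v : ℤ} (h : x * v - u * y ≠ 0)
    (hrange : ∀ z ∈ Z, z ∈ Set.range (linearSubst x u y v)) :
    ∃ b' c' d' e' : ℤ, quarticDisc (quarticEval a b c d e x y) b' c' d' e'
        = quarticDisc a b c d e * (x * v - u * y) ^ 12 ∧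
      ∃ Z' : Finset (ℤ × ℤ), Z.card ≤ Z'.card ∧
        IsSolutionSet (quarticEval a b c d e x y) b' c' d' e' Z' := by
  classical
  obtain ⟨b', c', d', e', heval, hdisc⟩ := exists_quartic_subst a b c d e x u y v
  refine ⟨b', c', d', e', hdisc, ?_⟩
  have h1 : (Z : Set (ℤ × ℤ)) ⊆ linearSubst x u y v '' Set.univ := by
    rw [Set.image_univ]
    exact fun z hz => hrange z hz
  obtain ⟨Z', -, rfl⟩ := Finset.subset_set_image_iff.1 h1
  refine ⟨Z', Finset.card_image_le, fun z hz => ?_, fun z hz w hw hzw => ?_⟩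
  · have h2 := hZ.1 _ (Finset.mem_image_of_mem _ hz)
    have h3 := heval ℤ z.1 z.2
    simp only [Int.cast_id] at h3
    rw [← h2, quarticEval, ← h3]
    rfl
  · have h2 := hZ.2 _ (Finset.mem_image_of_mem _ hz) _ (Finset.mem_image_of_mem _ hw)
      ((linearSubst_injective h).ne hzw)
    intro h3
    apply h2
    simp only [linearSubst]
    linear_combination (x * v - u * y) * h3

open Polynomial in
theorem exists_prod_eq_quartic (b c d e : ℤ) : ∃ α : Fin 4 → ℂ, ∀ X Y : ℂ,
    ∏ i, (X - α i * Y) = X ^ 4 + b * X ^ 3 * Y + c * X ^ 2 * Y ^ 2 + d * X * Y ^ 3 + e * Y ^ 4 := by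
  let p : ℂ[X] := X ^ 4 + C (b : ℂ) * X ^ 3 + C (c : ℂ) * X ^ 2 + C (d : ℂ) * X + C (e : ℂ)
  have hdeg : p.natDegree = 4 := by simp only [p]; compute_degree!
  have hmonic : p.Monic := by simp only [p]; monicity!
  have hs := IsAlgClosed.splits p
  have hcard := hs.natDegree_eq_card_roots
  rw [hdeg] at hcard
  obtain ⟨α, β, γ, δ, hr⟩ := Multiset.card_eq_four.1 hcard.symm
  have hp := hs.eq_prod_roots_of_monic hmonic
  rw [hr] at hp
  have hev : ∀ t : ℂ, t ^ 4 + b * t ^ 3 + c * t ^ 2 + d * t + e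
      = (t - α) * (t - β) * (t - γ) * (t - δ) := fun t => by
    have h := congrArg (eval t) hp
    simp only [p, eval_add, eval_mul, eval_pow, eval_X, eval_C, Multiset.insert_eq_cons,
      Multiset.map_cons, Multiset.map_singleton, Multiset.prod_cons, Multiset.prod_singleton,
      eval_sub] at h
    linear_combination h
  refine ⟨![α, β, γ, δ], fun X Y => ?_⟩
  rw [Fin.prod_univ_four]
  simp only [Matrix.cons_val]
  rcases eq_or_ne Y 0 with rfl | hY
  · ring
  · have h := hev (X / Y)
    field_simp at h
    linear_combination -h

theorem IsSolutionSet.exists_isAdmissible_of_monic {a b c d e : ℤ} (ha : |a| = 1)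
    (hdisc : 5 ^ 12 ≤ |quarticDisc a b c d e|) {Z : Finset (ℤ × ℤ)}
    (hZ : IsSolutionSet a b c d e Z) : ∃ α, IsAdmissible Z.card α := by
  have haa : a * a = 1 := by rw [← abs_mul_abs_self, ha, one_mul]
  obtain ⟨α, hα⟩ := exists_prod_eq_quartic (a * b) (a * c) (a * d) (a * e)
  refine ⟨α, ⟨_, _, _, _, hα⟩, ?_, Z, le_rfl, fun z hz => ?_, hZ.2⟩
  · have h1 := quarticDisc_eq_det_vandermonde_sq α _ _ _ _ hα
    have h2 : quarticDisc 1 (a * b) (a * c) (a * d) (a * e) = quarticDisc a b c d e := by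
      rcases (abs_eq one_pos.le).1 ha with rfl | rfl <;> simp only [quarticDisc] <;> ring
    rw [h2] at h1
    have h3 := congrArg norm h1
    rw [Complex.norm_intCast, norm_pow] at h3
    have h4 : (5 : ℝ) ^ 12 ≤ |(quarticDisc a b c d e : ℝ)| := by exact_mod_cast hdisc
    rw [h3] at h4
    exact le_of_sq_le_sq (by norm_num at h4 ⊢; exact h4) (norm_nonneg _)
  · have h1 := hZ.1 z hz
    have h2 : ∏ i, ((z.1 : ℂ) - α i * z.2) = ((a * quarticEval a b c d e z.1 z.2 : ℤ) : ℂ) := by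
      rw [hα]
      have h3 : (a : ℂ) * a = 1 := by exact_mod_cast haa
      simp only [quarticEval]
      push_cast
      linear_combination -(z.1 : ℂ) ^ 4 * h3
    rw [h2, Complex.norm_intCast]
    have h4 : |a * quarticEval a b c d e z.1 z.2| = 1 := by rw [abs_mul, ha, h1, one_mul]
    exact_mod_cast h4

theorem IsSolutionSet.exists_isAdmissible {a b c d e : ℤ}
    (hdisc : 5 ^ 12 ≤ |quarticDisc a b c d e|) {Z : Finset (ℤ × ℤ)}
    (hZ : IsSolutionSet a b c d e Z) (hN : 47 ≤ Z.card) : ∃ α, IsAdmissible 47 α := by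
  obtain ⟨⟨x, y⟩, hz⟩ : Z.Nonempty := Finset.card_pos.1 (by omega)
  have h1 := hZ.1 _ hz
  obtain ⟨p, q, hpq⟩ := isCoprime_of_abs_quarticEval_eq_one h1
  simp only at h1 hpq
  have hdet : x * p - -q * y = 1 := by linear_combination hpq
  obtain ⟨b', c', d', e', hd, Z', hcard, hZ'⟩ := hZ.exists_subst (x := x) (u := -q) (y := y)
    (v := p) (by rw [hdet]; exact one_ne_zero) fun z _ =>
    ⟨(p * z.1 + q * z.2, x * z.2 - y * z.1), by
      simp only [linearSubst]
      ext
      · linear_combination z.1 * hpq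
      · linear_combination z.2 * hpq⟩
  rw [hdet, one_pow, mul_one] at hd
  obtain ⟨α, hα⟩ := hZ'.exists_isAdmissible_of_monic h1 (by rwa [hd])
  obtain ⟨hf, hD, W, hW, h⟩ := hα
  exact ⟨α, hf, hD, W, by omega, h⟩

theorem exists_mem_range_linearSubst (z : ℤ × ℤ) : ∃ k : Option (Fin 5),
    z ∈ Set.range (linearSubst (k.elim 1 fun _ => 5) (k.elim 0 fun i => (i : ℕ)) 0
      (k.elim 5 fun _ => 1)) := by
  obtain ⟨x, y⟩ := z
  by_cases hy : (5 : ℤ) ∣ y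
  · obtain ⟨t, rfl⟩ := hy
    exact ⟨none, (x, t), by simp [linearSubst]⟩
  · obtain ⟨k, hk, t, ht⟩ : ∃ k : ℕ, k < 5 ∧ ∃ t : ℤ, x = 5 * t + k * y := by
      have h1 : ∃ w : ℤ, ∃ m : ℤ, w * y = 1 + 5 * m := by
        have h2 : y % 5 = 1 ∨ y % 5 = 2 ∨ y % 5 = 3 ∨ y % 5 = 4 := by omega
        rcases h2 with h | h | h | h
        · exact ⟨1, y / 5, by omega⟩
        · exact ⟨3, (3 * y) / 5, by omega⟩
        · exact ⟨2, (2 * y) / 5, by omega⟩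
        · exact ⟨4, (4 * y) / 5, by omega⟩
      obtain ⟨w, m, hw⟩ := h1
      have h2 := Int.emod_nonneg (x * w) (b := 5) (by norm_num)
      have h3 := Int.emod_lt_of_pos (x * w) (b := 5) (by norm_num)
      have h4 := Int.mul_ediv_add_emod (x * w) 5
      refine ⟨(x * w % 5).toNat, by omega, x * w / 5 * y - x * m, ?_⟩
      rw [Int.toNat_of_nonneg h2]
      linear_combination -x * hw - y * h4
    exact ⟨some ⟨k, hk⟩, (t, y), by simp [linearSubst, ht]⟩

theorem IsSolutionSet.card_le {a b c d e : ℤ} (h : quarticDisc a b c d e ≠ 0)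
    {Z : Finset (ℤ × ℤ)} (hZ : IsSolutionSet a b c d e Z) : Z.card ≤ 276 := by
  classical
  by_contra! hcard
  choose k hk using exists_mem_range_linearSubst
  obtain ⟨l, -, hl⟩ := Finset.exists_lt_card_fiber_of_mul_lt_card_of_maps_to (s := Z)
    (t := Finset.univ) (f := k) (n := 46) (fun z _ => Finset.mem_univ _) (by simpa using hcard)
  set W := Z.filter fun z => k z = l with hW
  have hWZ : IsSolutionSet a b c d e W :=
    ⟨fun z hz => hZ.1 z (Finset.mem_filter.1 hz).1, fun z hz w hw =>
      hZ.2 z (Finset.mem_filter.1 hz).1 w (Finset.mem_filter.1 hw).1⟩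
  have hdet : (l.elim 1 fun _ => 5 : ℤ) * (l.elim 5 fun _ => 1)
      - (l.elim 0 fun i => ((i : ℕ) : ℤ)) * 0 = 5 := by
    cases l <;> simp
  obtain ⟨b', c', d', e', hd, Z', hcard', hZ'⟩ := hWZ.exists_subst
    (by rw [hdet]; norm_num) fun z hz => by
      have h1 := hk z
      rwa [(Finset.mem_filter.1 hz).2] at h1
  rw [hdet] at hd
  obtain ⟨α, hα⟩ := hZ'.exists_isAdmissible (by
    rw [hd, abs_mul, abs_pow]
    exact le_mul_of_one_le_left (by positivity) (Int.one_le_abs h)) (by omega)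
  exact not_isAdmissible α hα

theorem eq_of_isCoprime_of_cross_eq_zero {z w : ℤ × ℤ} (hz : IsCoprime z.1 z.2)
    (hw : IsCoprime w.1 w.2) (hz0 : 0 < z.2 ∨ z.2 = 0 ∧ 0 < z.1)
    (hw0 : 0 < w.2 ∨ w.2 = 0 ∧ 0 < w.1) (h : z.1 * w.2 - w.1 * z.2 = 0) : z = w := by
  obtain ⟨x, y⟩ := z
  obtain ⟨x', y'⟩ := w
  simp only at *
  have h1 : y ∣ y' := hz.symm.dvd_of_dvd_mul_left ⟨x', by linear_combination h⟩
  have h2 : y' ∣ y := hw.symm.dvd_of_dvd_mul_left ⟨x, by linear_combination -h⟩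
  have hyy : y = y' := Int.dvd_antisymm (by omega) (by omega) h1 h2
  subst hyy
  rcases eq_or_ne y 0 with rfl | hy
  · have hx := Int.isUnit_iff.1 (isCoprime_zero_right.1 hz)
    have hx' := Int.isUnit_iff.1 (isCoprime_zero_right.1 hw)
    rw [Prod.mk.injEq]
    omega
  · have h3 : (x - x') * y = 0 := by linear_combination h
    have h4 := (mul_eq_zero.1 h3).resolve_right hy
    rw [sub_eq_zero.1 h4]

end Reduction

/-- A quartic Thue equation `|f(x,y)| = 1` with `Disc(f) ≠ 0` has at most 276 integer
solutions, where `(x,y)` and `(-x,-y)` are counted as the same solution. -/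
theorem quartic_thue_at_most_276_solutions (a b c d e : ℤ)
    (h : quarticDisc a b c d e ≠ 0) :
    ∃ S : Finset (ℤ × ℤ), S.card ≤ 276 ∧
      ∀ x y : ℤ, |quarticEval a b c d e x y| = 1 → (x, y) ∈ S ∨ (-x, -y) ∈ S := by
  let T : Set (ℤ × ℤ) :=
    {z | |quarticEval a b c d e z.1 z.2| = 1 ∧ (0 < z.2 ∨ z.2 = 0 ∧ 0 < z.1)}
  have hT : ∀ Z : Finset (ℤ × ℤ), (Z : Set (ℤ × ℤ)) ⊆ T → Z.card ≤ 276 := fun Z hZ => by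
    refine IsSolutionSet.card_le h ⟨fun z hz => (hZ hz).1, fun z hz w hw hzw h0 => hzw ?_⟩
    exact eq_of_isCoprime_of_cross_eq_zero (isCoprime_of_abs_quarticEval_eq_one (hZ hz).1)
      (isCoprime_of_abs_quarticEval_eq_one (hZ hw).1) (hZ hz).2 (hZ hw).2 h0
  have hfin : T.Finite := by
    by_contra hinf
    obtain ⟨Z, hZT, hZ⟩ := Set.Infinite.exists_subset_card_eq hinf 277
    have := hT Z hZT
    omega
  refine ⟨hfin.toFinset, hT _ (by simp), fun x y hxy => ?_⟩
  simp only [Set.Finite.mem_toFinset]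
  have hneg : |quarticEval a b c d e (-x) (-y)| = 1 := by
    rw [← hxy]
    congr 1
    simp only [quarticEval]
    ring
  have hne : ¬ (x = 0 ∧ y = 0) := by
    rintro ⟨rfl, rfl⟩
    simp [quarticEval] at hxy
  have hsign : (0 < y ∨ y = 0 ∧ 0 < x) ∨ (0 < -y ∨ -y = 0 ∧ 0 < -x) := by omega
  exact hsign.imp (fun hs => ⟨hxy, hs⟩) fun hs => ⟨hneg, hs⟩
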